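/- arXiv:1509.00934 — 8 statements merged into one kernel-verified Lean document; each statement's English description precedes it below -/
import Mathlib

section
/- Concentration of the empirical type counts under independent activation: fix η, M ∈ (0,∞) and δ > 0. There exists a constant K ∈ (0,∞), depending only on δ, η and M, such that the following holds. Let n ≥ 1 and let μ be a probability measure on ℕ with n·μ(r) ∈ ℕ for all r and ∑_r r^{5+η}·μ(r) ≤ M; take n vertices of which exactly n·μ(r) have degree r, and activate each half-edge independently with probability p ∈ [0,1]; let ξ_p(k,r) = n^{−1}·#{vertices of degree r with exactly k activated half-edges}. Then for every aₙ > 0: ℚ( ∑_{r≥0} ∑_{k=0}^{r} r²·|ξ_p(k,r) − μ(r)·C(r,k)p^k(1−p)^{r−k}| > δ·aₙ ) ≤ K·(aₙ^{1+η} + 1/√(n·aₙ³)), and ℚ( ∑_{r≥0} ∑_{k=0}^{r} r³·|ξ_p(k,r) − μ(r)·C(r,k)p^k(1−p)^{r−k}| > δ ) ≤ K·(aₙ^{1+η} + 1/√(n·aₙ³)), where C(r,k) is the binomial coefficient and ℚ is the law of the independent activations. -/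
open Set
open scoped Classical

/-- Probability weight of an activation pattern: each of the `H` half-edges is
activated independently with probability `p`. -/
noncomputable def bernWeight {H : ℕ} (p : ℝ) (ω : Fin H → Bool) : ℝ :=
  p ^ (Finset.univ.filter (fun e => ω e = true)).card *
    (1 - p) ^ (Finset.univ.filter (fun e => ω e = false)).card

/-- Probability of an event under independent activation of the half-edges. -/
noncomputable def bernProb {H : ℕ} (p : ℝ) (P : (Fin H → Bool) → Prop) : ℝ :=
  ∑ ω : Fin H → Bool, if P ω then bernWeight p ω else 0

/-- Number of activated half-edges at vertex v. -/
noncomputable def actCount {n H : ℕ} (owner : Fin H → Fin n) (ω : Fin H → Bool)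
    (v : Fin n) : ℕ :=
  (Finset.univ.filter (fun e => owner e = v ∧ ω e = true)).card

/-- Empirical fraction ξ_p(k,r) of vertices of degree r with exactly k
activated half-edges. -/
noncomputable def xiEmp {n H : ℕ} (deg : Fin n → ℕ) (owner : Fin H → Fin n)
    (ω : Fin H → Bool) (k r : ℕ) : ℝ :=
  ((Finset.univ.filter (fun v => deg v = r ∧ actCount owner ω v = k)).card : ℝ) / n

open Finset in
theorem sum_bernoulli_apply_card {α : Type*} [Fintype α] [DecidableEq α] (p : ℝ) (g : ℕ → ℝ) :
    ∑ s : α → Bool, (∏ e, if s e = true then p else 1 - p) *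
        g (univ.filter (fun e => s e = true)).card =
      ∑ k ∈ range (Fintype.card α + 1),
        ((Fintype.card α).choose k : ℝ) * p ^ k * (1 - p) ^ (Fintype.card α - k) * g k := by
  have h := Finset.sum_powerset_apply_card (x := (univ : Finset α))
    (fun k => p ^ k * (1 - p) ^ (Fintype.card α - k) * g k)
  simp only [nsmul_eq_mul, card_univ] at h
  refine Eq.trans ?_ (h.trans (sum_congr rfl fun k _ => by ring))
  refine Finset.sum_nbij' (fun s => univ.filter (fun e => s e = true))
    (fun t e => decide (e ∈ t)) ?_ ?_ ?_ ?_ ?_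
  · simp
  · simp
  · intro s _; ext e; simp
  · intro t _; ext e; simp
  · intro s _
    have h2 : (univ.filter (fun e => ¬ s e = true)).card =
        Fintype.card α - (univ.filter (fun e => s e = true)).card := by
      rw [← card_univ, ← card_filter_add_card_filter_not (s := univ) (fun e => s e = true)]
      omega
    rw [prod_ite, prod_const, prod_const, h2]

theorem bernWeight_eq_prod {H : ℕ} (p : ℝ) (ω : Fin H → Bool) :
    bernWeight p ω = ∏ e, if ω e = true then p else 1 - p := by
  simp [bernWeight, Finset.prod_ite]

open Finset in
/-- The activation counts of distinct vertices are independent binomial variables. -/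
theorem sum_bernWeight_mul_prod_actCount {n H : ℕ} (owner : Fin H → Fin n) (p : ℝ)
    (f : Fin n → ℕ → ℝ) (d : Fin n → ℕ)
    (hd : ∀ v, (univ.filter (fun e => owner e = v)).card = d v) :
    ∑ ω, bernWeight p ω * ∏ v, f v (actCount owner ω v) =
      ∏ v, ∑ k ∈ range (d v + 1),
        ((d v).choose k : ℝ) * p ^ k * (1 - p) ^ (d v - k) * f v k := by
  have hcard : ∀ v, Fintype.card {e // owner e = v} = d v := fun v => by
    rw [Fintype.card_subtype, hd]
  have h1 : ∀ v, ∑ k ∈ range (d v + 1),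
        ((d v).choose k : ℝ) * p ^ k * (1 - p) ^ (d v - k) * f v k =
      ∑ s : {e // owner e = v} → Bool, (∏ e, if s e = true then p else 1 - p) *
        f v (univ.filter (fun e => s e = true)).card := fun v => by
    rw [sum_bernoulli_apply_card, hcard]
  simp_rw [h1]
  rw [prod_univ_sum, Fintype.piFinset_univ]
  refine Fintype.sum_bijective
    (fun (ω : Fin H → Bool) (v : Fin n) (x : {e // owner e = v}) => ω x.1) ⟨?_, ?_⟩ _ _ ?_
  · intro ω ω' h
    ext e
    have := congrFun (congrFun h (owner e)) ⟨e, rfl⟩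
    simpa using this
  · intro s
    refine ⟨fun e => s (owner e) ⟨e, rfl⟩, ?_⟩
    ext v ⟨e, rfl⟩
    rfl
  · intro ω
    rw [prod_mul_distrib, bernWeight_eq_prod]
    congr 1
    · exact (Fintype.prod_fiberwise owner (fun e => if ω e = true then p else 1 - p)).symm
    · refine prod_congr rfl fun v _ => ?_
      congr 1
      rw [actCount]
      symm
      refine Finset.card_bij (fun x _ => x.1) ?_ ?_ ?_
      · rintro ⟨x, hx⟩ h; simpa [hx] using h
      · rintro x _ y _ h; exact Subtype.ext h
      · intro e he
        simp only [mem_filter, Finset.mem_univ, true_and] at he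
        exact ⟨⟨e, he.1⟩, by simpa using he.2, rfl⟩

theorem bernWeight_nonneg {H : ℕ} {p : ℝ} (hp : p ∈ Icc (0 : ℝ) 1) (ω : Fin H → Bool) :
    0 ≤ bernWeight p ω :=
  mul_nonneg (pow_nonneg hp.1 _) (pow_nonneg (sub_nonneg.2 hp.2) _)

/-- The weight of the binomial distribution with parameters `r` and `p` at `k`. -/
noncomputable def binomWeight (p : ℝ) (r k : ℕ) : ℝ :=
  (r.choose k : ℝ) * p ^ k * (1 - p) ^ (r - k)

theorem binomWeight_nonneg {p : ℝ} (hp : p ∈ Icc (0 : ℝ) 1) (r k : ℕ) :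
    0 ≤ binomWeight p r k :=
  mul_nonneg (mul_nonneg (Nat.cast_nonneg _) (pow_nonneg hp.1 _))
    (pow_nonneg (sub_nonneg.2 hp.2) _)

theorem sum_binomWeight (p : ℝ) (r : ℕ) :
    ∑ k ∈ Finset.range (r + 1), binomWeight p r k = 1 := by
  have h := add_pow p (1 - p) r
  rw [add_sub_cancel, one_pow] at h
  rw [h]
  exact Finset.sum_congr rfl fun k _ => by rw [binomWeight]; ring

section Variance

open Finset

variable {n H : ℕ} {owner : Fin H → Fin n} {d : Fin n → ℕ}

theorem sum_bernWeight_mul_actCount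
    (hd : ∀ v, (univ.filter (fun e => owner e = v)).card = d v) (p : ℝ) (g : ℕ → ℝ) (v : Fin n) :
    ∑ ω, bernWeight p ω * g (actCount owner ω v) =
      ∑ k ∈ range (d v + 1), binomWeight p (d v) k * g k := by
  have h := sum_bernWeight_mul_prod_actCount owner p
    (fun u k => if u = v then g k else 1) d hd
  simp only [prod_ite_eq', Finset.mem_univ, if_true] at h
  rw [h, prod_eq_single v]
  · simp [binomWeight]
  · intro u _ hu
    simpa [hu, binomWeight] using sum_binomWeight p (d u)
  · simp

theorem sum_bernWeight_eq_one
    (hd : ∀ v, (univ.filter (fun e => owner e = v)).card = d v) (p : ℝ) :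
    ∑ ω : Fin H → Bool, bernWeight p ω = 1 := by
  have h := sum_bernWeight_mul_prod_actCount owner p (fun _ _ => 1) d hd
  simp only [prod_const_one, mul_one] at h
  rw [h]
  exact prod_eq_one fun v _ => sum_binomWeight p (d v)

theorem sum_bernWeight_mul_actCount_mul_actCount
    (hd : ∀ v, (univ.filter (fun e => owner e = v)).card = d v) {p : ℝ} {g : ℕ → ℝ} {v w : Fin n}
    (hvw : v ≠ w) (hg : ∑ k ∈ range (d v + 1), binomWeight p (d v) k * g k = 0) :
    ∑ ω, bernWeight p ω * (g (actCount owner ω v) * g (actCount owner ω w)) = 0 := by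
  have h := sum_bernWeight_mul_prod_actCount owner p
    (fun u k => (if u = v then g k else 1) * (if u = w then g k else 1)) d hd
  simp only [prod_mul_distrib, prod_ite_eq', Finset.mem_univ, if_true] at h
  rw [h]
  refine prod_eq_zero (Finset.mem_univ v) ?_
  simpa [hvw, binomWeight] using hg

theorem sum_bernWeight_mul_sq_sum_actCount
    (hd : ∀ v, (univ.filter (fun e => owner e = v)).card = d v) {p : ℝ} {g : ℕ → ℝ} {r : ℕ}
    (hg : ∑ k ∈ range (r + 1), binomWeight p r k * g k = 0) (A : Finset (Fin n))
    (hA : ∀ v ∈ A, d v = r) :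
    ∑ ω, bernWeight p ω * (∑ v ∈ A, g (actCount owner ω v)) ^ 2 =
      A.card * ∑ k ∈ range (r + 1), binomWeight p r k * g k ^ 2 := by
  simp_rw [sq (∑ v ∈ A, _), sum_mul_sum]
  rw [← nsmul_eq_mul]
  simp_rw [mul_sum]
  rw [sum_comm]
  refine sum_eq_card_nsmul fun v hv => ?_
  rw [sum_comm, sum_eq_single v]
  · have h := sum_bernWeight_mul_actCount hd p (fun k => g k ^ 2) v
    rw [hA v hv] at h
    rw [← h]
    exact sum_congr rfl fun ω _ => by ring
  · intro w _ hw
    exact sum_bernWeight_mul_actCount_mul_actCount hd hw.symm (by rwa [hA v hv])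
  · exact fun h => absurd hv h

theorem sum_bernWeight_mul_sq_xiEmp_sub_le
    (hd : ∀ v, (univ.filter (fun e => owner e = v)).card = d v) {p : ℝ}
    (hn : 1 ≤ n) {k r : ℕ} (hk : k ≤ r) {m : ℝ}
    (hm : ((univ.filter (fun v => d v = r)).card : ℝ) = n * m) :
    ∑ ω, bernWeight p ω * (xiEmp d owner ω k r - m * binomWeight p r k) ^ 2 ≤
      m / n * binomWeight p r k := by
  have hn' : (0 : ℝ) < n := by exact_mod_cast hn
  set q := binomWeight p r k with hq
  set A := univ.filter (fun v => d v = r) with hAdef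
  have hkr : k ∈ range (r + 1) := Finset.mem_range.2 (by omega)
  have key : ∀ ω, xiEmp d owner ω k r - m * q =
      (∑ v ∈ A, ((if actCount owner ω v = k then 1 else 0) - q)) / n := by
    intro ω
    rw [sum_sub_distrib, sum_const, nsmul_eq_mul, hm, sum_boole, hAdef, filter_filter, xiEmp]
    field_simp
  have h1 : ∑ j ∈ range (r + 1), binomWeight p r j * ((if j = k then (1 : ℝ) else 0) - q) = 0 := by
    simp only [mul_sub, sum_sub_distrib, ← sum_mul, sum_binomWeight]
    simp [hq, hk]
  have h2 : ∑ j ∈ range (r + 1), binomWeight p r j * ((if j = k then (1 : ℝ) else 0) - q) ^ 2 =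
      q - q ^ 2 := by
    have : ∀ j, binomWeight p r j * ((if j = k then (1 : ℝ) else 0) - q) ^ 2 =
        (1 - 2 * q) * (if j = k then binomWeight p r j else 0) + q ^ 2 * binomWeight p r j := by
      intro j; split_ifs <;> ring
    simp only [this, sum_add_distrib, ← mul_sum, sum_binomWeight, sum_ite_eq', hkr, if_true]
    ring
  have h3 := sum_bernWeight_mul_sq_sum_actCount (g := fun j => (if j = k then (1 : ℝ) else 0) - q)
    hd h1 A (fun v hv => (mem_filter.1 hv).2)
  simp only [key, div_pow, ← mul_div_assoc, ← sum_div]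
  rw [h3, h2, hm]
  have hm0 : 0 ≤ m := by
    have : (0 : ℝ) ≤ n * m := hm ▸ Nat.cast_nonneg _
    exact nonneg_of_mul_nonneg_right this hn'
  rw [div_mul_eq_mul_div, div_le_div_iff₀ (by positivity) hn']
  nlinarith [mul_nonneg (mul_nonneg hm0 (sq_nonneg q)) (sq_nonneg (n : ℝ))]

/-- The total deviation of the empirical counts of the vertices of degree `r`. -/
noncomputable def typeDev (d : Fin n → ℕ) (owner : Fin H → Fin n) (p : ℝ) (μ : ℕ → ℝ)
    (ω : Fin H → Bool) (r : ℕ) : ℝ :=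
  ∑ k ∈ range (r + 1), |xiEmp d owner ω k r - μ r * binomWeight p r k|

theorem typeDev_nonneg (p : ℝ) (μ : ℕ → ℝ) (ω : Fin H → Bool) (r : ℕ) :
    0 ≤ typeDev d owner p μ ω r :=
  sum_nonneg fun _ _ => abs_nonneg _

theorem typeDev_le {p : ℝ} (hp : p ∈ Icc (0 : ℝ) 1) (hn : 1 ≤ n) {μ : ℕ → ℝ}
    (hμ : ∀ r, ((univ.filter (fun v => d v = r)).card : ℝ) = n * μ r) (hμ0 : ∀ r, 0 ≤ μ r)
    (ω : Fin H → Bool) (r : ℕ) :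
    typeDev d owner p μ ω r ≤ 2 * μ r := by
  have hn' : (0 : ℝ) < n := by exact_mod_cast hn
  have hξ0 : ∀ k, 0 ≤ xiEmp d owner ω k r := fun k => by unfold xiEmp; positivity
  have hξ : ∑ k ∈ range (r + 1), xiEmp d owner ω k r ≤ μ r := by
    simp only [xiEmp]
    rw [← sum_div, div_le_iff₀ hn', mul_comm, ← hμ, ← Nat.cast_sum, Nat.cast_le]
    simp only [← filter_filter]
    rw [sum_card_fiberwise_eq_card_filter]
    exact card_filter_le _ _
  have hb : ∀ k, 0 ≤ μ r * binomWeight p r k := fun k =>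
    mul_nonneg (hμ0 r) (binomWeight_nonneg hp r k)
  calc typeDev d owner p μ ω r
      ≤ ∑ k ∈ range (r + 1), (xiEmp d owner ω k r + μ r * binomWeight p r k) :=
        sum_le_sum fun k _ => by
          rw [abs_le]; constructor <;> linarith [hξ0 k, hb k]
    _ ≤ 2 * μ r := by
        rw [sum_add_distrib, ← mul_sum, sum_binomWeight]; linarith

theorem sum_bernWeight_mul_sq_typeDev_le
    (hd : ∀ v, (univ.filter (fun e => owner e = v)).card = d v) {p : ℝ}
    (hp : p ∈ Icc (0 : ℝ) 1) (hn : 1 ≤ n) {μ : ℕ → ℝ}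
    (hμ : ∀ r, ((univ.filter (fun v => d v = r)).card : ℝ) = n * μ r) (r : ℕ) :
    ∑ ω, bernWeight p ω * typeDev d owner p μ ω r ^ 2 ≤ (r + 1) * (μ r / n) := by
  calc ∑ ω, bernWeight p ω * typeDev d owner p μ ω r ^ 2
      ≤ ∑ ω, bernWeight p ω * ((r + 1) * ∑ k ∈ range (r + 1),
          (xiEmp d owner ω k r - μ r * binomWeight p r k) ^ 2) := by
        refine sum_le_sum fun ω _ => mul_le_mul_of_nonneg_left ?_ (bernWeight_nonneg hp ω)
        simpa [typeDev, sq_abs] using sq_sum_le_card_mul_sum_sq (s := range (r + 1))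
          (f := fun k => |xiEmp d owner ω k r - μ r * binomWeight p r k|)
    _ = (r + 1) * ∑ k ∈ range (r + 1), ∑ ω, bernWeight p ω *
          (xiEmp d owner ω k r - μ r * binomWeight p r k) ^ 2 := by
        rw [sum_comm, mul_sum]
        refine sum_congr rfl fun ω _ => ?_
        rw [← mul_sum]; ring
    _ ≤ (r + 1) * ∑ k ∈ range (r + 1), μ r / n * binomWeight p r k := by
        refine mul_le_mul_of_nonneg_left (sum_le_sum fun k hk => ?_) (by positivity)
        exact sum_bernWeight_mul_sq_xiEmp_sub_le hd hn
          (Nat.lt_succ_iff.1 (Finset.mem_range.1 hk)) (hμ r)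
    _ = (r + 1) * (μ r / n) := by rw [← mul_sum, sum_binomWeight, mul_one]

theorem sum_bernWeight_mul_sq_sum_typeDev_le
    (hd : ∀ v, (univ.filter (fun e => owner e = v)).card = d v) {p : ℝ}
    (hp : p ∈ Icc (0 : ℝ) 1) (hn : 1 ≤ n) {μ : ℕ → ℝ}
    (hμ : ∀ r, ((univ.filter (fun v => d v = r)).card : ℝ) = n * μ r) (hμ0 : ∀ r, 0 ≤ μ r)
    {M : ℝ} (F : Finset ℕ) (hM : ∑ r ∈ F, (r : ℝ) ^ 5 * μ r ≤ M) :
    ∑ ω, bernWeight p ω * (∑ r ∈ F, (r : ℝ) ^ 2 * typeDev d owner p μ ω r) ^ 2 ≤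
      F.card * (2 * M / n) := by
  calc ∑ ω, bernWeight p ω * (∑ r ∈ F, (r : ℝ) ^ 2 * typeDev d owner p μ ω r) ^ 2
      ≤ ∑ ω, bernWeight p ω * (F.card * ∑ r ∈ F, (r : ℝ) ^ 4 * typeDev d owner p μ ω r ^ 2) := by
        refine sum_le_sum fun ω _ => mul_le_mul_of_nonneg_left ?_ (bernWeight_nonneg hp ω)
        refine sq_sum_le_card_mul_sum_sq.trans_eq ?_
        congr 1
        exact sum_congr rfl fun r _ => by ring
    _ = F.card * ∑ r ∈ F, (r : ℝ) ^ 4 * ∑ ω, bernWeight p ω * typeDev d owner p μ ω r ^ 2 := by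
        simp only [mul_sum]
        rw [sum_comm]
        exact sum_congr rfl fun r _ => sum_congr rfl fun ω _ => by ring
    _ ≤ F.card * ∑ r ∈ F, 2 / n * ((r : ℝ) ^ 5 * μ r) := by
        refine mul_le_mul_of_nonneg_left (sum_le_sum fun r _ => ?_) (by positivity)
        refine (mul_le_mul_of_nonneg_left
          (sum_bernWeight_mul_sq_typeDev_le hd hp hn hμ r) (by positivity)).trans ?_
        have h : (r : ℝ) ^ 4 * (r + 1) ≤ 2 * (r : ℝ) ^ 5 := by
          rcases Nat.eq_zero_or_pos r with rfl | hr
          · simp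
          · have hr' : (1 : ℝ) ≤ r := by exact_mod_cast hr
            nlinarith [pow_nonneg (Nat.cast_nonneg r : (0 : ℝ) ≤ r) 4]
        have h2 : 0 ≤ μ r / n := div_nonneg (hμ0 r) (Nat.cast_nonneg n)
        calc (r : ℝ) ^ 4 * ((r + 1) * (μ r / n)) = (r : ℝ) ^ 4 * (r + 1) * (μ r / n) := by ring
          _ ≤ 2 * (r : ℝ) ^ 5 * (μ r / n) := mul_le_mul_of_nonneg_right h h2
          _ = 2 / n * ((r : ℝ) ^ 5 * μ r) := by ring
    _ ≤ F.card * (2 * M / n) := by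
        refine mul_le_mul_of_nonneg_left ?_ (by positivity)
        rw [← mul_sum, div_mul_eq_mul_div]
        gcongr

theorem bernProb_le_one
    (hd : ∀ v, (univ.filter (fun e => owner e = v)).card = d v) {p : ℝ}
    (hp : p ∈ Icc (0 : ℝ) 1) (P : (Fin H → Bool) → Prop) : bernProb p P ≤ 1 := by
  rw [← sum_bernWeight_eq_one hd p]
  refine sum_le_sum fun ω _ => ?_
  split_ifs
  exacts [le_rfl, bernWeight_nonneg hp ω]

/-- Chebyshev's inequality for the activation probability. -/
theorem bernProb_le_of_imp_lt {p : ℝ} (hp : p ∈ Icc (0 : ℝ) 1) {P : (Fin H → Bool) → Prop}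
    {X : (Fin H → Bool) → ℝ} {t : ℝ} (ht : 0 < t) (h : ∀ ω, P ω → t < X ω) :
    bernProb p P ≤ (∑ ω, bernWeight p ω * X ω ^ 2) / t ^ 2 := by
  rw [sum_div]
  refine sum_le_sum fun ω _ => ?_
  have hW := bernWeight_nonneg hp ω
  split_ifs with hω
  · rw [le_div_iff₀ (by positivity)]
    exact mul_le_mul_of_nonneg_left (pow_le_pow_left₀ ht.le (h ω hω).le 2) hW
  · positivity

/-- The total deviation of order `j` splits at the degree `R`, with a deterministic bound on the
contribution of the larger degrees. -/
theorem tsum_typeDev_le {p : ℝ} (hp : p ∈ Icc (0 : ℝ) 1) (hn : 1 ≤ n) {μ : ℕ → ℝ}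
    (hμ : ∀ r, ((univ.filter (fun v => d v = r)).card : ℝ) = n * μ r) (hμ0 : ∀ r, 0 ≤ μ r)
    {M : ℝ} (hM : ∀ F : Finset ℕ, ∑ r ∈ F, (r : ℝ) ^ 5 * μ r ≤ M) (ω : Fin H → Bool)
    {R : ℝ} (hR : 0 < R) {i j : ℕ} (hij : i + j = 5) :
    ∑' r : ℕ, (r : ℝ) ^ j * typeDev d owner p μ ω r ≤
      (∑ r ∈ range (⌊R⌋₊ + 1), (r : ℝ) ^ j * typeDev d owner p μ ω r) + 2 * M / R ^ i := by
  have hle := typeDev_le (owner := owner) hp hn hμ hμ0 ω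
  have h0 := typeDev_nonneg (d := d) (owner := owner) p μ ω
  have hM0 : 0 ≤ M := by simpa using hM ∅
  refine Real.tsum_le_of_sum_le (fun r => mul_nonneg (by positivity) (h0 r)) fun F => ?_
  rw [← sum_filter_add_sum_filter_not F (fun r => r ∈ range (⌊R⌋₊ + 1))]
  gcongr ?_ + ?_
  · refine sum_le_sum_of_subset_of_nonneg (fun r hr => (mem_filter.1 hr).2) fun r _ _ =>
      mul_nonneg (by positivity) (h0 r)
  · rw [le_div_iff₀ (by positivity), sum_mul]
    calc _ ≤ ∑ r ∈ F.filter (fun r => ¬ r ∈ range (⌊R⌋₊ + 1)), 2 * ((r : ℝ) ^ 5 * μ r) := by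
          refine sum_le_sum fun r hr => ?_
          have hr' : R ≤ r := by
            have := (mem_filter.1 hr).2
            rw [Finset.mem_range, not_lt] at this
            exact (Nat.lt_of_floor_lt (by omega)).le
          calc (r : ℝ) ^ j * typeDev d owner p μ ω r * R ^ i
              ≤ (r : ℝ) ^ j * (2 * μ r) * (r : ℝ) ^ i := by
                have := hle r
                have := hμ0 r
                gcongr
            _ = 2 * ((r : ℝ) ^ 5 * μ r) := by rw [← hij, pow_add]; ring
      _ ≤ 2 * M := by rw [← mul_sum]; linarith [hM (F.filter (fun r => ¬ r ∈ range (⌊R⌋₊ + 1)))]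

end Variance

theorem le_sqrt_of_le_one_of_le {x y : ℝ} (hx : x ≤ 1) (hxy : x ≤ y) : x ≤ √y := by
  rcases le_total x 0 with h | h
  · exact h.trans (Real.sqrt_nonneg y)
  · exact Real.le_sqrt_of_sq_le (by nlinarith)

/-- concentration of the empirical type counts under independent
activation. -/
theorem stmt8
    (η M : ℝ) (hη : 0 < η) (hM : 0 < M) (δ : ℝ) (hδ : 0 < δ) :
    ∃ K : ℝ, 0 < K ∧
      ∀ n : ℕ, 1 ≤ n → ∀ μ : ℕ → ℝ, (∀ r, 0 ≤ μ r) → Summable μ → (∑' r : ℕ, μ r = 1) →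
        (∀ F : Finset ℕ, ∑ r ∈ F, (r : ℝ) ^ ((5 : ℝ) + η) * μ r ≤ M) →
        ∀ deg : Fin n → ℕ,
          (∀ r : ℕ, ((Finset.univ.filter (fun v => deg v = r)).card : ℝ) = n * μ r) →
          ∀ owner : Fin (∑ v, deg v) → Fin n,
            (∀ v : Fin n, (Finset.univ.filter (fun e => owner e = v)).card = deg v) →
            ∀ p ∈ Icc (0:ℝ) 1, ∀ a : ℝ, 0 < a →
              bernProb p (fun ω =>
                  δ * a < ∑' r : ℕ, ∑ k ∈ Finset.range (r + 1), (r : ℝ) ^ 2 *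
                    |xiEmp deg owner ω k r -
                      μ r * (r.choose k : ℝ) * p ^ k * (1 - p) ^ (r - k)|) ≤
                K * (a ^ ((1 : ℝ) + η) + 1 / Real.sqrt (n * a ^ 3)) ∧
              bernProb p (fun ω =>
                  δ < ∑' r : ℕ, ∑ k ∈ Finset.range (r + 1), (r : ℝ) ^ 3 *
                    |xiEmp deg owner ω k r -
                      μ r * (r.choose k : ℝ) * p ^ k * (1 - p) ^ (r - k)|) ≤
                K * (a ^ ((1 : ℝ) + η) + 1 / Real.sqrt (n * a ^ 3)) := by
  obtain ⟨C, hC1, hC2⟩ : ∃ C : ℝ, 1 ≤ C ∧ 4 * M ≤ C * δ :=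
    ⟨max 1 (4 * M / δ), le_max_left _ _, (div_le_iff₀ hδ).1 (le_max_right _ _)⟩
  have hC0 : 0 < C := by linarith
  set L : ℝ := 16 * M * C ^ 3 / δ ^ 2 with hL
  refine ⟨1 + √L, by positivity, ?_⟩
  intro n hn μ hμ0 _ _ hMom deg hdeg owner howner p hp a ha
  have hn' : (0 : ℝ) < n := by exact_mod_cast hn
  have hM5 : ∀ F : Finset ℕ, ∑ r ∈ F, (r : ℝ) ^ 5 * μ r ≤ M := fun F => by
    refine le_trans (Finset.sum_le_sum fun r _ => ?_) (hMom F)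
    refine mul_le_mul_of_nonneg_right ?_ (hμ0 r)
    rcases Nat.eq_zero_or_pos r with rfl | hr
    · simpa using Real.rpow_nonneg le_rfl _
    · rw [← Real.rpow_natCast]
      exact Real.rpow_le_rpow_of_exponent_le (by exact_mod_cast hr) (by push_cast; linarith)
  have hdev : ∀ (ω : Fin (∑ v, deg v) → Bool) (j : ℕ),
      (∑' r : ℕ, ∑ k ∈ Finset.range (r + 1), (r : ℝ) ^ j *
        |xiEmp deg owner ω k r - μ r * (r.choose k : ℝ) * p ^ k * (1 - p) ^ (r - k)|) =
      ∑' r : ℕ, (r : ℝ) ^ j * typeDev deg owner p μ ω r := fun ω j =>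
    tsum_congr fun r => by
      simp only [typeDev, binomWeight, Finset.mul_sum, ← mul_assoc]
  simp only [hdev]
  rcases le_or_gt 1 a with ha1 | ha1
  · have h1 : 1 ≤ (1 + √L) * (a ^ ((1 : ℝ) + η) + 1 / √(n * a ^ 3)) := by
      have := Real.one_le_rpow ha1 (by linarith : 0 ≤ 1 + η)
      have h2 : 0 ≤ 1 / √(n * a ^ 3) := by positivity
      nlinarith [Real.sqrt_nonneg L]
    exact ⟨(bernProb_le_one howner hp _).trans h1, (bernProb_le_one howner hp _).trans h1⟩
  set R : ℝ := C / a with hR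
  have hR1 : 1 ≤ R := (one_le_div ha).2 (by linarith)
  set F := Finset.range (⌊R⌋₊ + 1) with hF
  have hcard : (F.card : ℝ) ≤ 2 * R := by
    rw [hF, Finset.card_range]
    push_cast
    linarith [Nat.floor_le (by linarith : 0 ≤ R)]
  have hMR : 2 * M / R ≤ δ * a / 2 := by
    rw [hR, div_div_eq_mul_div, div_le_iff₀ hC0]
    nlinarith
  have hbound : ∀ P : (Fin (∑ v, deg v) → Bool) → Prop,
      (∀ ω, P ω → δ * a / (2 * C) < ∑ r ∈ F, (r : ℝ) ^ 2 * typeDev deg owner p μ ω r) →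
      bernProb p P ≤ (1 + √L) * (a ^ ((1 : ℝ) + η) + 1 / √(n * a ^ 3)) := by
    intro P hP
    have h1 : bernProb p P ≤ L / (n * a ^ 3) := by
      refine (bernProb_le_of_imp_lt hp (by positivity) hP).trans ?_
      rw [div_le_iff₀ (by positivity)]
      refine (sum_bernWeight_mul_sq_sum_typeDev_le howner hp hn hdeg hμ0 F (hM5 F)).trans ?_
      calc (F.card : ℝ) * (2 * M / n) ≤ 2 * R * (2 * M / n) := by gcongr
        _ = L / (n * a ^ 3) * (δ * a / (2 * C)) ^ 2 := by
            rw [hL, hR]; field_simp; norm_num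
    refine (le_sqrt_of_le_one_of_le (bernProb_le_one howner hp P) h1).trans ?_
    rw [Real.sqrt_div' _ (by positivity), div_eq_mul_one_div]
    have h2 : 0 ≤ 1 / √(n * a ^ 3) := by positivity
    have h3 : 0 ≤ a ^ ((1 : ℝ) + η) := by positivity
    nlinarith [Real.sqrt_nonneg L, mul_nonneg (Real.sqrt_nonneg L) h3]
  have hpow : ∀ i : ℕ, 1 ≤ i → 2 * M / R ^ i ≤ δ * a / 2 := fun i hi => by
    refine le_trans ?_ hMR
    gcongr
    exact le_self_pow₀ hR1 (by omega)
  constructor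
  · refine hbound _ fun ω hω => ?_
    have h := tsum_typeDev_le (owner := owner) hp hn hdeg hμ0 hM5 ω (by linarith : 0 < R)
      (show 3 + 2 = 5 from rfl)
    have h2 := hpow 3 (by norm_num)
    have h3 : δ * a / (2 * C) ≤ δ * a / 2 := by gcongr; linarith
    linarith
  · refine hbound _ fun ω hω => ?_
    have h := tsum_typeDev_le (owner := owner) hp hn hdeg hμ0 hM5 ω (by linarith : 0 < R)
      (show 2 + 3 = 5 from rfl)
    have h2 := hpow 2 (by norm_num)
    have h3 : ∑ r ∈ F, (r : ℝ) ^ 3 * typeDev deg owner p μ ω r ≤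
        R * ∑ r ∈ F, (r : ℝ) ^ 2 * typeDev deg owner p μ ω r := by
      rw [Finset.mul_sum]
      refine Finset.sum_le_sum fun r hr => ?_
      have hr' : (r : ℝ) ≤ R := by
        rw [hF, Finset.mem_range] at hr
        exact (Nat.le_floor_iff (by linarith)).1 (by omega)
      have h4 := mul_nonneg (sq_nonneg (r : ℝ)) (typeDev_nonneg (d := deg) (owner := owner) p μ ω r)
      calc (r : ℝ) ^ 3 * typeDev deg owner p μ ω r
          = r * ((r : ℝ) ^ 2 * typeDev deg owner p μ ω r) := by ring
        _ ≤ _ := mul_le_mul_of_nonneg_right hr' h4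
    have h4 : δ / 2 < R * ∑ r ∈ F, (r : ℝ) ^ 2 * typeDev deg owner p μ ω r := by
      nlinarith
    rw [hR, div_mul_eq_mul_div, lt_div_iff₀ ha] at h4
    rw [div_lt_iff₀ (by positivity)]
    linarith
end

section
/- Combinatorial exchangeability of the in-solution activation order: fix N ≥ 1, degrees d₁,…,d_N ∈ ℕ and a threshold α ∈ ℕ. For every S ⊆ {1,…,N}, every k, r ∈ ℕ, every ℓ, ℓ' ∈ L'_{S,k} and every ℓ̄ ∈ L_{Sᶜ,r}, the number of sequences σ ∈ L_{{1,…,N},k+r} such that the subsequence of σ consisting of arms of particles of S equals ℓ, the subsequence of σ consisting of arms of particles of Sᶜ equals ℓ̄, and S(σ) = S, is equal to the corresponding number with ℓ replaced by ℓ'. -/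
open Set

/-- The arms: particle `i` carries `d i` arms. -/
abbrev Arm (N : ℕ) (d : Fin N → ℕ) : Type := (i : Fin N) × Fin (d i)

/-- State of the coagulation-with-gelation procedure: a labelling of the
particles by cluster representatives, the set of particles lying in gel
clusters, and the (at most one) pending arm. -/
structure CoagState (N : ℕ) (d : Fin N → ℕ) where
  label : Fin N → Fin N
  gel : Finset (Fin N)
  pending : Option (Arm N d)

/-- Initial state: every particle is a singleton cluster, no gel, no pending arm. -/
def initState (N : ℕ) (d : Fin N → ℕ) : CoagState N d := ⟨id, ∅, none⟩

/-- One step of the procedure with threshold α, processing arm `e`. An arm of a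
gel particle is ignored; otherwise it is linked to the pending arm if there is
one (merging the corresponding clusters, the merged cluster falling into the
gel if it has at least α particles), and becomes pending otherwise. -/
def coagStep (N : ℕ) (d : Fin N → ℕ) (α : ℕ) (s : CoagState N d) (e : Arm N d) :
    CoagState N d :=
  if e.1 ∈ s.gel then s
  else
    match s.pending with
    | none => { s with pending := some e }
    | some e₀ =>
      let newLabel : Fin N → Fin N :=
        fun w => if s.label w = s.label e₀.1 then s.label e.1 else s.label w
      let cluster : Finset (Fin N) :=
        Finset.univ.filter (fun w => newLabel w = newLabel e.1)
      { label := newLabel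
        gel := if α ≤ cluster.card then s.gel ∪ cluster else s.gel
        pending := none }

/-- Set S(σ) of particles remaining in solution after processing the sequence σ. -/
def solSet (N : ℕ) (d : Fin N → ℕ) (α : ℕ) (σ : List (Arm N d)) : Finset (Fin N) :=
  Finset.univ \ (σ.foldl (coagStep N d α) (initState N d)).gel

/-- L_{S,k}: injective sequences of k distinct arms attached to particles of S. -/
def memL (N : ℕ) (d : Fin N → ℕ) (S : Finset (Fin N)) (k : ℕ) (ℓ : List (Arm N d)) : Prop :=
  ℓ.Nodup ∧ ℓ.length = k ∧ ∀ e ∈ ℓ, e.1 ∈ S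

/-- L'_{S,k}: sequences in L_{S,k} whose consecutive pairing creates no cluster
of α or more particles (equivalently, running the procedure produces no gel). -/
def memL' (N : ℕ) (d : Fin N → ℕ) (α : ℕ) (S : Finset (Fin N)) (k : ℕ)
    (ℓ : List (Arm N d)) : Prop :=
  memL N d S k ℓ ∧ (ℓ.foldl (coagStep N d α) (initState N d)).gel = ∅

/-- Replace, in order, the entries of a list satisfying `p` by the entries of a second list. -/
def List.replaceFilter {β : Type*} (p : β → Bool) : List β → List β → List β
  | [], _ => []
  | a :: σ, l =>
    if p a then
      match l with
      | [] => []
      | b :: l => b :: List.replaceFilter p σ l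
    else a :: List.replaceFilter p σ l

namespace List

variable {β : Type*} {p : β → Bool}

theorem filter_replaceFilter {σ l : List β} (hlen : (σ.filter p).length = l.length)
    (hl : ∀ b ∈ l, p b) : (σ.replaceFilter p l).filter p = l := by
  induction σ generalizing l with
  | nil => cases l <;> simp_all [replaceFilter]
  | cons a σ ih =>
    by_cases ha : p a
    · cases l with
      | nil => simp_all
      | cons b l => simp_all [replaceFilter]
    · simp_all [replaceFilter]

theorem filter_not_replaceFilter {σ l : List β} (hlen : (σ.filter p).length = l.length)
    (hl : ∀ b ∈ l, p b) :
    (σ.replaceFilter p l).filter (fun b => !p b) = σ.filter (fun b => !p b) := by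
  induction σ generalizing l with
  | nil => simp [replaceFilter]
  | cons a σ ih =>
    by_cases ha : p a
    · cases l with
      | nil => simp_all
      | cons b l => simp_all [replaceFilter]
    · simp_all [replaceFilter]

theorem replaceFilter_replaceFilter {σ l : List β} (hlen : (σ.filter p).length = l.length)
    (hl : ∀ b ∈ l, p b) : (σ.replaceFilter p l).replaceFilter p (σ.filter p) = σ := by
  induction σ generalizing l with
  | nil => simp [replaceFilter]
  | cons a σ ih =>
    by_cases ha : p a
    · cases l with
      | nil => simp_all
      | cons b l => simp_all [replaceFilter]
    · simp_all [replaceFilter]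

theorem forall₂_replaceFilter {σ l : List β} (hlen : (σ.filter p).length = l.length)
    (hl : ∀ b ∈ l, p b) :
    Forall₂ (fun a b => (p a ∧ p b) ∨ (¬ p a ∧ a = b)) σ (σ.replaceFilter p l) := by
  induction σ generalizing l with
  | nil => simp [replaceFilter]
  | cons a σ ih =>
    by_cases ha : p a
    · cases l with
      | nil => simp_all
      | cons b l => simp_all [replaceFilter]
    · simp_all [replaceFilter]

theorem Nodup.of_filter {σ : List β} (h : (σ.filter p).Nodup)
    (h' : (σ.filter (fun b => !p b)).Nodup) : σ.Nodup := by
  rw [← (filter_append_perm p σ).nodup_iff, nodup_append]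
  refine ⟨h, h', fun a ha b hb hab => ?_⟩
  subst hab
  simp_all

end List

section Coagulation

variable {N : ℕ} {d : Fin N → ℕ} {α : ℕ}

/-- The gel is a union of clusters, and the pending arm does not belong to it. -/
def CoagState.Saturated (s : CoagState N d) : Prop :=
  (∀ x y, s.label x = s.label y → x ∈ s.gel → y ∈ s.gel) ∧ ∀ e ∈ s.pending, e.1 ∉ s.gel

theorem CoagState.Saturated.coagStep {s : CoagState N d} (hs : s.Saturated) (e : Arm N d) :
    (coagStep N d α s e).Saturated := by
  obtain ⟨h1, h2⟩ := hs
  rcases s with ⟨label, gel, _ | e₀⟩ <;> simp only [Saturated, _root_.coagStep] at *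
  · by_cases he : e.1 ∈ gel <;> simpa [he] using h1
  · by_cases he : e.1 ∈ gel
    · simpa [he] using And.intro h1 h2
    · simp only [he, if_false]
      refine ⟨fun x y hxy => ?_, by simp⟩
      simp only [Option.mem_def, Option.some.injEq, forall_eq'] at h2
      split_ifs <;> grind

theorem label_coagStep {s : CoagState N d} {x y : Fin N} (h : s.label x = s.label y)
    (e : Arm N d) : (coagStep N d α s e).label x = (coagStep N d α s e).label y := by
  rcases s with ⟨label, gel, _ | e₀⟩ <;> simp only [coagStep] at * <;> split_ifs <;> simp_all

theorem gel_subset_coagStep (s : CoagState N d) (e : Arm N d) :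
    s.gel ⊆ (coagStep N d α s e).gel := by
  rcases s with ⟨label, gel, _ | e₀⟩ <;> simp only [coagStep] <;> split_ifs <;> simp

theorem gel_subset_foldl_coagStep (s : CoagState N d) (σ : List (Arm N d)) :
    s.gel ⊆ (σ.foldl (coagStep N d α) s).gel := by
  induction σ generalizing s with
  | nil => simp
  | cons e σ ih => exact (gel_subset_coagStep s e).trans (ih _)

theorem mem_gel_foldl_coagStep {s : CoagState N d} (hs : s.Saturated) {x y : Fin N}
    (h : s.label x = s.label y) {σ : List (Arm N d)}
    (hx : x ∈ (σ.foldl (coagStep N d α) s).gel) : y ∈ (σ.foldl (coagStep N d α) s).gel := by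
  induction σ generalizing s with
  | nil => exact hs.1 x y h hx
  | cons e σ ih => exact ih (hs.coagStep e) (label_coagStep h e) hx

theorem label_coagStep_of_pending {s : CoagState N d} {e e₀ : Arm N d}
    (hp : s.pending = some e₀) (he : e.1 ∉ s.gel) :
    (coagStep N d α s e).label e₀.1 = (coagStep N d α s e).label e.1 := by
  simp [coagStep, hp, he]

/-- Linking the particles of two arms makes them share their final gel membership. -/
theorem mem_gel_iff_of_pending {s : CoagState N d} (hs : s.Saturated) {e e₀ : Arm N d}
    (hp : s.pending = some e₀) (he : e.1 ∉ s.gel) (σ : List (Arm N d)) :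
    e₀.1 ∈ ((e :: σ).foldl (coagStep N d α) s).gel ↔
      e.1 ∈ ((e :: σ).foldl (coagStep N d α) s).gel :=
  have h := label_coagStep_of_pending (α := α) hp he
  ⟨mem_gel_foldl_coagStep (hs.coagStep e) h, mem_gel_foldl_coagStep (hs.coagStep e) h.symm⟩

/-- A gel-free state in which only particles of `S` have been linked. -/
structure CoagState.Inside (S : Finset (Fin N)) (t : CoagState N d) : Prop where
  gel_eq : t.gel = ∅
  label_mem : ∀ w, t.label w ∈ S ↔ w ∈ S
  pending_mem : ∀ e ∈ t.pending, e.1 ∈ S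

/-- A state in which only particles outside `S` have been linked. -/
structure CoagState.Outside (S : Finset (Fin N)) (u : CoagState N d) : Prop where
  gel_notMem : ∀ w ∈ S, w ∉ u.gel
  label_mem : ∀ w, u.label w ∈ S ↔ w ∈ S
  pending_notMem : ∀ e ∈ u.pending, e.1 ∉ S

/-- Juxtaposition of a state inside `S` and a state outside `S`. -/
def CoagState.combine (S : Finset (Fin N)) (t u : CoagState N d) : CoagState N d where
  label w := if w ∈ S then t.label w else u.label w
  gel := u.gel
  pending := t.pending <|> u.pending

open CoagState

variable {S : Finset (Fin N)}

theorem CoagState.Inside.coagStep {t : CoagState N d} (ht : t.Inside S) {e : Arm N d}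
    (he : e.1 ∈ S) (hgel : (coagStep N d α t e).gel = ∅) : (coagStep N d α t e).Inside S := by
  obtain ⟨h1, h2, h3⟩ := ht
  refine ⟨hgel, ?_, ?_⟩ <;> rcases t with ⟨label, gel, _ | e₀⟩ <;> subst h1 <;>
    simp_all [_root_.coagStep]
  intro w
  split_ifs <;> grind

theorem CoagState.Outside.coagStep {u : CoagState N d} (hu : u.Outside S) {e : Arm N d}
    (he : e.1 ∉ S) : (coagStep N d α u e).Outside S := by
  obtain ⟨h1, h2, h3⟩ := hu
  by_cases heg : e.1 ∈ u.gel
  · simpa [_root_.coagStep, heg] using ⟨h1, h2, h3⟩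
  rcases u with ⟨label, gel, _ | e₀⟩
  · constructor <;> simp_all [_root_.coagStep]
  · simp only [Option.mem_def, Option.some.injEq, forall_eq'] at h3
    simp only [_root_.coagStep, heg, if_false]
    refine ⟨fun w hw => ?_, fun w => ?_, by simp⟩
    · split_ifs <;> simp only [Finset.mem_union, Finset.mem_filter, Finset.mem_univ, true_and] <;>
        grind
    · grind

theorem isSome_pending_coagStep {t : CoagState N d} (ht : t.gel = ∅) (e : Arm N d) :
    (coagStep N d α t e).pending.isSome = !t.pending.isSome := by
  rcases t with ⟨label, gel, _ | e₀⟩ <;> subst ht <;> simp [coagStep]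

theorem coagStep_combine_inside {t u : CoagState N d} (ht : t.Inside S) (hu : u.Outside S)
    {e : Arm N d} (he : e.1 ∈ S) (hp : u.pending = none)
    (hgel : (coagStep N d α t e).gel = ∅) :
    coagStep N d α (t.combine S u) e = (coagStep N d α t e).combine S u := by
  obtain ⟨h1, h2, h3⟩ := ht
  obtain ⟨g1, g2, g3⟩ := hu
  rcases t with ⟨label, gel, _ | e₀⟩ <;> subst h1
  · simp [coagStep, combine, he, hp, g1]
  · simp only [Option.mem_def, Option.some.injEq, forall_eq'] at h2 h3
    have hcl : ∀ w, ((if (if w ∈ S then label w else u.label w) = label e₀.1 then label e.1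
          else if w ∈ S then label w else u.label w) = label e.1) ↔
        (if label w = label e₀.1 then label e.1 else label w) = label e.1 := by
      intro w; grind
    simp only [coagStep, combine, he, hp, g1, if_true, Finset.notMem_empty, if_false] at hgel ⊢
    simp only [Option.orElse_eq_orElse, Option.orElse_eq_or, Option.or_none, h3, if_true,
      ite_self, hcl] at hgel ⊢
    split_ifs at hgel with hα
    · have : e.1 ∈ (∅ : Finset (Fin N)) := hgel ▸ by simp
      simp at this
    · simp only [hα, if_false, CoagState.mk.injEq, and_true]
      funext w
      grind

theorem coagStep_combine_outside {t u : CoagState N d} (ht : t.Inside S) (hu : u.Outside S)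
    {e : Arm N d} (he : e.1 ∉ S) (hp : e.1 ∈ u.gel ∨ t.pending = none) :
    coagStep N d α (t.combine S u) e = t.combine S (coagStep N d α u e) := by
  obtain ⟨h1, h2, h3⟩ := ht
  obtain ⟨g1, g2, g3⟩ := hu
  by_cases heg : e.1 ∈ u.gel
  · simp [coagStep, combine, heg]
  · replace hp := hp.resolve_left heg
    rcases u with ⟨label, gel, _ | e₀⟩
    · simp_all [coagStep, combine]
    · simp only [Option.mem_def, Option.some.injEq, forall_eq'] at g2 g3
      have hcl : ∀ w, ((if (if w ∈ S then t.label w else label w) = label e₀.1 then label e.1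
            else if w ∈ S then t.label w else label w) = label e.1) ↔
          (if label w = label e₀.1 then label e.1 else label w) = label e.1 := by
        intro w; grind
      simp only [coagStep, combine, he, hp, heg, if_false]
      simp only [Option.orElse_eq_orElse, Option.orElse_eq_or, Option.none_or, g3, if_false,
        ite_self, hcl, CoagState.mk.injEq, and_true]
      funext w
      grind

/-- If a process ends up with gel exactly `Sᶜ`, then replacing its arms in `S` by other arms
in `S` which by themselves do not produce gel preserves this property. -/
theorem gel_foldl_eq_compl {σ σ' : List (Arm N d)}
    (hσ : List.Forall₂ (fun a b => (a.1 ∈ S ∧ b.1 ∈ S) ∨ (a.1 ∉ S ∧ a = b)) σ σ')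
    {t t' u : CoagState N d} (ht : t.Inside S) (ht' : t'.Inside S) (hu : u.Outside S)
    (hpend : t.pending.isSome = t'.pending.isSome) (hone : t.pending = none ∨ u.pending = none)
    (hsat : (t.combine S u).Saturated)
    (hf : ((σ.filter (fun e => decide (e.1 ∈ S))).foldl (coagStep N d α) t).gel = ∅)
    (hf' : ((σ'.filter (fun e => decide (e.1 ∈ S))).foldl (coagStep N d α) t').gel = ∅)
    (hgel : (σ.foldl (coagStep N d α) (t.combine S u)).gel = Sᶜ) :
    (σ'.foldl (coagStep N d α) (t'.combine S u)).gel = Sᶜ := by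
  induction hσ generalizing t t' u with
  | nil => exact hgel
  | @cons a b σ σ' hab _ ih =>
    rcases hab with ⟨ha, hb⟩ | ⟨ha, rfl⟩
    · simp only [ha, hb, decide_true, List.filter_cons_of_pos, List.foldl_cons] at hf hf'
      have hg := Finset.subset_empty.1 ((gel_subset_foldl_coagStep _ _).trans hf.subset)
      have hg' := Finset.subset_empty.1 ((gel_subset_foldl_coagStep _ _).trans hf'.subset)
      have hup : u.pending = none := by
        by_contra hne
        obtain ⟨e₀, he₀⟩ := Option.ne_none_iff_exists'.1 hne
        have htp := hone.resolve_right hne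
        have := mem_gel_iff_of_pending (α := α) (e := a) (e₀ := e₀) hsat
          (by simp [combine, htp, he₀]) (hu.gel_notMem _ ha) σ
        rw [hgel] at this
        simp [ha, hu.pending_notMem e₀ he₀] at this
      have hstep := coagStep_combine_inside ht hu ha hup hg
      rw [List.foldl_cons, hstep] at hgel
      rw [List.foldl_cons, coagStep_combine_inside ht' hu hb hup hg']
      exact ih (ht.coagStep ha hg) (ht'.coagStep hb hg') hu
        (by rw [isSome_pending_coagStep ht.gel_eq, isSome_pending_coagStep ht'.gel_eq, hpend])
        (Or.inr hup) (hstep ▸ hsat.coagStep a) hf hf' hgel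
    · simp only [ha, decide_false, Bool.false_eq_true, not_false_eq_true,
        List.filter_cons_of_neg] at hf hf'
      have hp : a.1 ∈ u.gel ∨ t.pending = none := by
        by_contra! hne
        obtain ⟨hag, hne⟩ := hne
        obtain ⟨e₀, he₀⟩ := Option.ne_none_iff_exists'.1 hne
        have := mem_gel_iff_of_pending (α := α) (e := a) (e₀ := e₀) hsat
          (by simp [combine, he₀]) hag σ
        rw [hgel] at this
        simp [ha, ht.pending_mem e₀ he₀] at this
      have hp' : a.1 ∈ u.gel ∨ t'.pending = none := by
        refine hp.imp_right fun h => ?_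
        simpa [h] using hpend.symm
      have hstep := coagStep_combine_outside (α := α) ht hu ha hp
      rw [List.foldl_cons, hstep] at hgel
      rw [List.foldl_cons, coagStep_combine_outside ht' hu ha hp']
      refine ih ht ht' (hu.coagStep ha) hpend ?_ (hstep ▸ hsat.coagStep a) hf hf' hgel
      rcases hp with hag | h
      · simpa [coagStep, hag] using hone
      · exact Or.inl h

theorem solSet_eq_iff (σ : List (Arm N d)) :
    solSet N d α σ = S ↔ (σ.foldl (coagStep N d α) (initState N d)).gel = Sᶜ := by
  rw [solSet, ← Finset.compl_eq_univ_sdiff, compl_eq_comm, eq_comm]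

theorem solSet_eq_of_forall₂ {σ σ' : List (Arm N d)}
    (hσ : List.Forall₂ (fun a b => (a.1 ∈ S ∧ b.1 ∈ S) ∨ (a.1 ∉ S ∧ a = b)) σ σ')
    (hf : ((σ.filter (fun e => decide (e.1 ∈ S))).foldl (coagStep N d α) (initState N d)).gel = ∅)
    (hf' : ((σ'.filter (fun e => decide (e.1 ∈ S))).foldl (coagStep N d α)
      (initState N d)).gel = ∅)
    (h : solSet N d α σ = S) : solSet N d α σ' = S := by
  rw [solSet_eq_iff] at h ⊢
  have hc : (initState N d).combine S (initState N d) = initState N d := by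
    simp [combine, initState, Function.id_def]
  have hi : (initState N d).Inside S := by constructor <;> simp [initState]
  have ho : (initState N d).Outside S := by constructor <;> simp [initState]
  rw [← hc] at h ⊢
  exact gel_foldl_eq_compl hσ hi hi ho rfl (Or.inl rfl) (by rw [hc]; simp [initState, Saturated])
    hf hf' h

theorem ncard_interleavings_le {k r : ℕ} {ℓ ℓ' ℓbar : List (Arm N d)}
    (hℓ : memL' N d α S k ℓ) (hℓ' : memL' N d α S k ℓ') :
    {σ : List (Arm N d) |
        memL N d Finset.univ (k + r) σ ∧
        σ.filter (fun e => decide (e.1 ∈ S)) = ℓ ∧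
        σ.filter (fun e => decide (e.1 ∈ Sᶜ)) = ℓbar ∧
        solSet N d α σ = S}.ncard ≤
    {σ : List (Arm N d) |
        memL N d Finset.univ (k + r) σ ∧
        σ.filter (fun e => decide (e.1 ∈ S)) = ℓ' ∧
        σ.filter (fun e => decide (e.1 ∈ Sᶜ)) = ℓbar ∧
        solSet N d α σ = S}.ncard := by
  have hcompl : (fun e : Arm N d => decide (e.1 ∈ Sᶜ)) = fun e => !decide (e.1 ∈ S) := by
    funext e; simp
  have hmem : ∀ b ∈ ℓ', decide (b.1 ∈ S) = true := fun b hb => by simpa using hℓ'.1.2.2 b hb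
  refine Set.ncard_le_ncard_of_injOn
    (fun σ => σ.replaceFilter (fun e => decide (e.1 ∈ S)) ℓ') ?_ ?_
    ((List.finite_length_eq (Arm N d) (k + r)).subset fun σ h => h.1.2.1)
  · rintro σ ⟨⟨hnd, hlen, -⟩, hS, hbar, hsol⟩
    have hl : (σ.filter (fun e => decide (e.1 ∈ S))).length = ℓ'.length := by
      rw [hS, hℓ.1.2.1, hℓ'.1.2.1]
    have hin := List.filter_replaceFilter hl hmem
    have hout := List.filter_not_replaceFilter hl hmem
    have hrel := List.forall₂_replaceFilter hl hmem
    refine ⟨⟨.of_filter (hin.symm ▸ hℓ'.1.1) (hout ▸ hnd.filter _),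
      hrel.length_eq ▸ hlen, by simp⟩, hin, ?_, ?_⟩
    · rw [hcompl] at hbar ⊢
      exact hout.trans hbar
    · exact solSet_eq_of_forall₂ (by simpa using hrel) (hS.symm ▸ hℓ.2) (hin.symm ▸ hℓ'.2) hsol
  · refine Set.LeftInvOn.injOn
      (f₁' := fun σ => σ.replaceFilter (fun e => decide (e.1 ∈ S)) ℓ) ?_
    rintro σ ⟨-, rfl, -⟩
    exact List.replaceFilter_replaceFilter (by rw [hℓ.1.2.1, hℓ'.1.2.1]) hmem

end Coagulation

/-- combinatorial exchangeability of the in-solution activation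
order. -/
theorem stmt11
    (N : ℕ) (d : Fin N → ℕ) (α : ℕ) (S : Finset (Fin N)) (k r : ℕ)
    (ℓ ℓ' : List (Arm N d))
    (hℓ : memL' N d α S k ℓ) (hℓ' : memL' N d α S k ℓ')
    (ℓbar : List (Arm N d)) (hℓbar : memL N d Sᶜ r ℓbar) :
    {σ : List (Arm N d) |
        memL N d Finset.univ (k + r) σ ∧
        σ.filter (fun e => decide (e.1 ∈ S)) = ℓ ∧
        σ.filter (fun e => decide (e.1 ∈ Sᶜ)) = ℓbar ∧
        solSet N d α σ = S}.ncard =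
    {σ : List (Arm N d) |
        memL N d Finset.univ (k + r) σ ∧
        σ.filter (fun e => decide (e.1 ∈ S)) = ℓ' ∧
        σ.filter (fun e => decide (e.1 ∈ Sᶜ)) = ℓbar ∧
        solSet N d α σ = S}.ncard := by
  exact le_antisymm (ncard_interleavings_le hℓ hℓ') (ncard_interleavings_le hℓ' hℓ)
end

section
/- Unique fixed point of the tilt equation for supercritical offspring laws: let ν be a probability measure on ℕ with ν(0) > 0 and 1 < ∑_{k≥1} k·ν(k) < ∞. Then the equation c·G_ν'(c) = G_ν(c) has a unique solution c in the open interval (0,1), and moreover G_ν'(c) < 1, i.e. β = 1/G_ν'(c) > 1. -/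
open Filter Topology Set

/-- Generating function of a (sub)probability measure on ℕ. -/
noncomputable def Gfun (ν : ℕ → ℝ) (x : ℝ) : ℝ := ∑' k : ℕ, ν k * x ^ k

/-- Derivative series of the generating function: G_ν'(x) = ∑_{k≥1} k ν(k) x^{k-1}. -/
noncomputable def Gder (ν : ℕ → ℝ) (x : ℝ) : ℝ := ∑' k : ℕ, ((k : ℝ) + 1) * ν (k + 1) * x ^ k

/-- The series of `x * G'(x) - G(x) + ν 0`, with nonnegative coefficients. -/
noncomputable def tiltSeries (ν : ℕ → ℝ) (x : ℝ) : ℝ := ∑' k : ℕ, (k : ℝ) * ν (k + 1) * x ^ (k + 1)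

theorem Summable.mul_pow_of_mem_Icc {a : ℕ → ℝ} (ha : ∀ k, 0 ≤ a k) (hs : Summable a)
    {x : ℝ} (hx : x ∈ Icc (0 : ℝ) 1) (e : ℕ → ℕ) : Summable fun k => a k * x ^ e k :=
  hs.of_nonneg_of_le (fun k => mul_nonneg (ha k) (pow_nonneg hx.1 _))
    fun k => mul_le_of_le_one_right (ha k) (pow_le_one₀ hx.1 hx.2)

/-- The tangent line of `x ^ (k + 1)` at `c` lies below the power at `1`. -/
theorem tangent_pow_le_one {c : ℝ} (hc : 0 ≤ c) (k : ℕ) :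
    ((k : ℝ) + 1) * c ^ k - k * c ^ (k + 1) ≤ 1 := by
  induction k with
  | zero => simp
  | succ k ih =>
    have h : 0 ≤ ((k : ℝ) + 1) * c ^ k * (1 - c) ^ 2 := by positivity
    push_cast
    linear_combination ih + h

theorem tangent_pow_lt_one {c : ℝ} (hc : c ∈ Ioo (0 : ℝ) 1) {k : ℕ} (hk : k ≠ 0) :
    ((k : ℝ) + 1) * c ^ k - k * c ^ (k + 1) < 1 := by
  obtain ⟨k, rfl⟩ := Nat.exists_eq_succ_of_ne_zero hk
  have h0 := hc.1
  have h1 : 0 < 1 - c := sub_pos.2 hc.2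
  have h : 0 < ((k : ℝ) + 1) * c ^ k * (1 - c) ^ 2 := by positivity
  have ih := tangent_pow_le_one h0.le k
  push_cast [Nat.succ_eq_add_one]
  linear_combination ih + h

section Tilt

variable {ν : ℕ → ℝ}

theorem summable_succ_mul (hm : Summable fun k : ℕ => (k : ℝ) * ν k) :
    Summable fun k : ℕ => ((k : ℝ) + 1) * ν (k + 1) := by
  simpa using (summable_nat_add_iff 1).2 hm

theorem summable_mul_succ (hs : Summable ν) (hm : Summable fun k : ℕ => (k : ℝ) * ν k) :
    Summable fun k : ℕ => (k : ℝ) * ν (k + 1) := by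
  refine ((summable_succ_mul hm).sub ((summable_nat_add_iff 1).2 hs)).congr fun k => ?_
  ring

theorem mul_Gder_sub_Gfun (hν : ∀ k, 0 ≤ ν k) (hs : Summable ν)
    (hm : Summable fun k : ℕ => (k : ℝ) * ν k) {x : ℝ} (hx : x ∈ Icc (0 : ℝ) 1) :
    x * Gder ν x - Gfun ν x = tiltSeries ν x - ν 0 := by
  have h1 := (summable_succ_mul hm).mul_pow_of_mem_Icc
    (fun k => mul_nonneg (by positivity) (hν _)) hx id
  have h2 := hs.mul_pow_of_mem_Icc hν hx id
  have h3 := (summable_nat_add_iff 1).2 h2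
  simp only [id] at h1 h2 h3
  rw [Gder, Gfun, tiltSeries, h2.tsum_eq_zero_add, ← tsum_mul_left, pow_zero, mul_one,
    add_comm (ν 0), ← sub_sub, ← (h1.mul_left x).tsum_sub h3]
  congr 1
  exact tsum_congr fun k => by ring

theorem exists_succ_pos_of_one_lt_mean (hν : ∀ k, 0 ≤ ν k) (hs : Summable ν)
    (hprob : ∑' k, ν k = 1) (hm1 : 1 < ∑' k : ℕ, (k : ℝ) * ν k) :
    ∃ k, k ≠ 0 ∧ 0 < ν (k + 1) := by
  by_contra! h
  have hz : ∀ k : ℕ, k ≠ 1 → (k : ℝ) * ν k = 0 := by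
    rintro (_ | _ | k) hk
    · simp
    · exact absurd rfl hk
    · rw [le_antisymm (h (k + 1) k.succ_ne_zero) (hν _), mul_zero]
  rw [tsum_eq_single 1 hz, Nat.cast_one, one_mul] at hm1
  exact (hprob ▸ hs.le_tsum 1 fun k _ => hν k).not_gt hm1

theorem strictMonoOn_tiltSeries (hν : ∀ k, 0 ≤ ν k) (hs : Summable ν)
    (hm : Summable fun k : ℕ => (k : ℝ) * ν k) {n : ℕ} (hn : n ≠ 0) (hpos : 0 < ν (n + 1)) :
    StrictMonoOn (tiltSeries ν) (Icc 0 1) := by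
  intro x hx y hy hxy
  have hnn : ∀ k : ℕ, 0 ≤ (k : ℝ) * ν (k + 1) := fun k => mul_nonneg k.cast_nonneg (hν _)
  have h := summable_mul_succ hs hm
  refine Summable.tsum_lt_tsum (i := n)
    (fun k => mul_le_mul_of_nonneg_left (pow_le_pow_left₀ hx.1 hxy.le _) (hnn k)) ?_
    (h.mul_pow_of_mem_Icc hnn hx (· + 1)) (h.mul_pow_of_mem_Icc hnn hy (· + 1))
  exact mul_lt_mul_of_pos_left (pow_lt_pow_left₀ hxy hx.1 n.succ_ne_zero)
    (mul_pos (Nat.cast_pos.2 hn.bot_lt) hpos)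

theorem continuousOn_tiltSeries (hν : ∀ k, 0 ≤ ν k) (hs : Summable ν)
    (hm : Summable fun k : ℕ => (k : ℝ) * ν k) : ContinuousOn (tiltSeries ν) (Icc 0 1) := by
  refine continuousOn_tsum (fun k => by fun_prop) (summable_mul_succ hs hm) fun k x hx => ?_
  have hnn : 0 ≤ (k : ℝ) * ν (k + 1) := mul_nonneg k.cast_nonneg (hν _)
  rw [Real.norm_of_nonneg (mul_nonneg hnn (pow_nonneg hx.1 _))]
  exact mul_le_of_le_one_right hnn (pow_le_one₀ hx.1 hx.2)

theorem lt_tiltSeries_one (hs : Summable ν) (hprob : ∑' k, ν k = 1)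
    (hm : Summable fun k : ℕ => (k : ℝ) * ν k) (hm1 : 1 < ∑' k : ℕ, (k : ℝ) * ν k) :
    ν 0 < tiltSeries ν 1 := by
  have h : tiltSeries ν 1 = ∑' k : ℕ, (((k : ℝ) + 1) * ν (k + 1) - ν (k + 1)) :=
    tsum_congr fun k => by ring
  rw [(summable_succ_mul hm).tsum_sub ((summable_nat_add_iff 1).2 hs)] at h
  rw [hs.tsum_eq_zero_add] at hprob
  rw [hm.tsum_eq_zero_add] at hm1
  push_cast at hm1
  linarith

theorem Gder_lt_one_of_tiltSeries_eq (hν : ∀ k, 0 ≤ ν k) (hs : Summable ν)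
    (hprob : ∑' k, ν k = 1) (hm : Summable fun k : ℕ => (k : ℝ) * ν k)
    {n : ℕ} (hn : n ≠ 0) (hpos : 0 < ν (n + 1)) {c : ℝ} (hc : c ∈ Ioo (0 : ℝ) 1)
    (h : tiltSeries ν c = ν 0) : Gder ν c < 1 := by
  have hc' := Ioo_subset_Icc_self hc
  have h1 := (summable_succ_mul hm).mul_pow_of_mem_Icc
    (fun k => mul_nonneg (by positivity) (hν _)) hc' id
  have h2 := (summable_mul_succ hs hm).mul_pow_of_mem_Icc
    (fun k => mul_nonneg k.cast_nonneg (hν _)) hc' (· + 1)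
  simp only [id] at h1
  have hlt : Gder ν c - tiltSeries ν c < ∑' k, ν (k + 1) := by
    rw [Gder, tiltSeries, ← h1.tsum_sub h2]
    refine Summable.tsum_lt_tsum (i := n) (fun k => ?_) ?_ (h1.sub h2)
      ((summable_nat_add_iff 1).2 hs)
    · linear_combination mul_le_mul_of_nonneg_left (tangent_pow_le_one hc.1.le k) (hν (k + 1))
    · linear_combination mul_lt_mul_of_pos_left (tangent_pow_lt_one hc hn) hpos
  rw [hs.tsum_eq_zero_add] at hprob
  linarith

end Tilt

/-- unique fixed point of the tilt equation for supercritical offspring laws. -/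
theorem stmt14
    (ν : ℕ → ℝ) (hν : ∀ k, 0 ≤ ν k) (hsum : Summable ν) (hprob : ∑' k : ℕ, ν k = 1)
    (h0 : 0 < ν 0)
    (hm1sum : Summable (fun k : ℕ => (k : ℝ) * ν k))
    (hm1 : 1 < ∑' k : ℕ, (k : ℝ) * ν k) :
    (∃! c : ℝ, c ∈ Ioo (0:ℝ) 1 ∧ c * Gder ν c = Gfun ν c) ∧
    ∀ c ∈ Ioo (0:ℝ) 1, c * Gder ν c = Gfun ν c → Gder ν c < 1 := by
  obtain ⟨n, hn, hpos⟩ := exists_succ_pos_of_one_lt_mean hν hsum hprob hm1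
  have key : ∀ c ∈ Ioo (0 : ℝ) 1, c * Gder ν c = Gfun ν c ↔ tiltSeries ν c = ν 0 := by
    intro c hc
    rw [← sub_eq_zero, mul_Gder_sub_Gfun hν hsum hm1sum (Ioo_subset_Icc_self hc), sub_eq_zero]
  refine ⟨?_, fun c hc h =>
    Gder_lt_one_of_tiltSeries_eq hν hsum hprob hm1sum hn hpos hc ((key c hc).1 h)⟩
  have hzero : tiltSeries ν 0 = 0 := by simp [tiltSeries]
  obtain ⟨c, hc, hceq⟩ := intermediate_value_Ioo zero_le_one
    (continuousOn_tiltSeries hν hsum hm1sum)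
    ⟨hzero.symm ▸ h0, lt_tiltSeries_one hsum hprob hm1sum hm1⟩
  refine ⟨c, ⟨hc, (key c hc).2 hceq⟩, fun d ⟨hd, hdeq⟩ => ?_⟩
  exact (strictMonoOn_tiltSeries hν hsum hm1sum hn hpos).injOn (Ioo_subset_Icc_self hd)
    (Ioo_subset_Icc_self hc) (((key d hd).1 hdeq).trans hceq.symm)
end

section
/- Long-time limit of the post-gelation function Q: let μ be a probability measure on ℕ with 0 < m₁^μ, m₂^μ < ∞, m₂^μ > m₁^μ, μ(1) > 0 and μ(k) > 0 for some k ≥ 3, and let ν = μ̂. For t ≥ T_gel let Q(t) ∈ (e^{−t},1] be the unique solution of (Q(t) − e^{−t})·G_ν'(Q(t)) = G_ν(Q(t)). Then Q(t) converges as t → ∞ to the unique solution c ∈ (0,1) of c·G_ν'(c) = G_ν(c). -/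
open Set Filter Topology

/-- First factorial moment m₁ = ∑ k μ(k). -/
noncomputable def fm1 (μ : ℕ → ℝ) : ℝ := ∑' k : ℕ, (k : ℝ) * μ k

/-- Second factorial moment m₂ = ∑ k(k-1) μ(k). -/
noncomputable def fm2 (μ : ℕ → ℝ) : ℝ := ∑' k : ℕ, (k : ℝ) * ((k : ℝ) - 1) * μ k

/-- Size-biased, shifted-by-one law μ̂. -/
noncomputable def hatMu (μ : ℕ → ℝ) (k : ℕ) : ℝ := ((k : ℝ) + 1) * μ (k + 1) / fm1 μ

/-- Gelation time T_gel = - log (1 - m₁/m₂). -/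
noncomputable def Tgel (μ : ℕ → ℝ) : ℝ := - Real.log (1 - fm1 μ / fm2 μ)

/-- A power series with summable coefficients converges on `[0, 1]`. -/
theorem summable_mul_pow_of_mem_Icc {a : ℕ → ℝ} (ha : Summable a) {x : ℝ} (hx : x ∈ Icc (0:ℝ) 1) :
    Summable fun k => a k * x ^ k := by
  refine Summable.of_norm_bounded ha.abs fun k => ?_
  rw [Real.norm_eq_abs, abs_mul, abs_of_nonneg (pow_nonneg hx.1 k)]
  exact mul_le_of_le_one_right (abs_nonneg _) (pow_le_one₀ hx.1 hx.2)

/-- `x G_ν'(x) - G_ν(x) = ∑ (k - 1) ν(k) x^k`. -/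
theorem hasSum_mul_Gder_sub_Gfun {ν : ℕ → ℝ} (hs : Summable ν)
    (hs1 : Summable fun k : ℕ => (k : ℝ) * ν k) {x : ℝ} (hx : x ∈ Icc (0:ℝ) 1) :
    HasSum (fun k : ℕ => ((k : ℝ) - 1) * ν k * x ^ k) (x * Gder ν x - Gfun ν x) := by
  have h0 := summable_mul_pow_of_mem_Icc hs hx
  have h1 := summable_mul_pow_of_mem_Icc hs1 hx
  have hder : x * Gder ν x = ∑' k : ℕ, (k : ℝ) * ν k * x ^ k := by
    rw [h1.tsum_eq_zero_add, Gder, ← tsum_mul_left]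
    simp only [Nat.cast_zero, zero_mul, zero_add, Nat.cast_add, Nat.cast_one]
    exact tsum_congr fun k => by ring
  rw [hder]
  exact (h1.hasSum.sub h0.hasSum).congr_fun fun k => by ring

theorem strictMonoOn_mul_Gder_sub_Gfun {ν : ℕ → ℝ} (hν : ∀ k, 0 ≤ ν k) (hs : Summable ν)
    (hs1 : Summable fun k : ℕ => (k : ℝ) * ν k) (h2 : ∃ k, 2 ≤ k ∧ 0 < ν k) :
    StrictMonoOn (fun x => x * Gder ν x - Gfun ν x) (Icc 0 1) := by
  intro x hx y hy hxy
  obtain ⟨n, hn, hνn⟩ := h2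
  refine hasSum_lt (i := n) (fun k => ?_) ?_ (hasSum_mul_Gder_sub_Gfun hs hs1 hx)
    (hasSum_mul_Gder_sub_Gfun hs hs1 hy)
  · rcases Nat.eq_zero_or_pos k with rfl | hk
    · simp
    · have hk' : (1 : ℝ) ≤ k := by exact_mod_cast hk
      exact mul_le_mul_of_nonneg_left (pow_le_pow_left₀ hx.1 hxy.le k)
        (mul_nonneg (by linarith) (hν k))
  · have hn' : (2 : ℝ) ≤ n := by exact_mod_cast hn
    exact mul_lt_mul_of_pos_left (pow_lt_pow_left₀ hxy hx.1 (by omega))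
      (mul_pos (by linarith) hνn)

theorem Gder_le_Gder_one {ν : ℕ → ℝ} (hν : ∀ k, 0 ≤ ν k)
    (hs1 : Summable fun k : ℕ => (k : ℝ) * ν k) {x : ℝ} (hx : x ∈ Icc (0:ℝ) 1) :
    Gder ν x ≤ Gder ν 1 := by
  have h : Summable fun k : ℕ => ((k : ℝ) + 1) * ν (k + 1) := by
    simpa using (summable_nat_add_iff 1).2 hs1
  refine (summable_mul_pow_of_mem_Icc h hx).tsum_le_tsum (fun k => ?_)
    (summable_mul_pow_of_mem_Icc h ⟨zero_le_one, le_rfl⟩)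
  exact mul_le_mul_of_nonneg_left (pow_le_pow_left₀ hx.1 hx.2 k)
    (mul_nonneg (by positivity) (hν _))

theorem Gder_nonneg {ν : ℕ → ℝ} (hν : ∀ k, 0 ≤ ν k) {x : ℝ} (hx : 0 ≤ x) : 0 ≤ Gder ν x :=
  tsum_nonneg fun k => mul_nonneg (mul_nonneg (by positivity) (hν _)) (pow_nonneg hx k)

/-- long-time limit of the post-gelation function Q. -/
theorem stmt15
    (μ : ℕ → ℝ) (hμ : ∀ k, 0 ≤ μ k) (hsum : Summable μ) (hprob : ∑' k : ℕ, μ k = 1)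
    (hm1sum : Summable (fun k : ℕ => (k : ℝ) * μ k))
    (hm2sum : Summable (fun k : ℕ => (k : ℝ) * ((k : ℝ) - 1) * μ k))
    (hm1 : 0 < fm1 μ) (hm12 : fm1 μ < fm2 μ)
    (hμ1 : 0 < μ 1) (h3 : ∃ k : ℕ, 3 ≤ k ∧ 0 < μ k)
    (Q : ℝ → ℝ)
    (hQ : ∀ t : ℝ, Tgel μ ≤ t → Q t ∈ Ioc (Real.exp (-t)) 1 ∧
      (Q t - Real.exp (-t)) * Gder (hatMu μ) (Q t) = Gfun (hatMu μ) (Q t))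
    (c : ℝ) (hc : c ∈ Ioo (0:ℝ) 1) (hceq : c * Gder (hatMu μ) c = Gfun (hatMu μ) c) :
    Tendsto Q atTop (nhds c) := by
  have hν : ∀ k, 0 ≤ hatMu μ k := fun k =>
    div_nonneg (mul_nonneg (by positivity) (hμ _)) hm1.le
  have hs : Summable (hatMu μ) := by
    refine (((summable_nat_add_iff 1).2 hm1sum).div_const (fm1 μ)).congr fun k => ?_
    simp only [hatMu, Nat.cast_add, Nat.cast_one]
  have hs1 : Summable fun k : ℕ => (k : ℝ) * hatMu μ k := by
    refine (((summable_nat_add_iff 1).2 hm2sum).div_const (fm1 μ)).congr fun k => ?_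
    simp only [hatMu]
    push_cast
    ring
  have h2 : ∃ k, 2 ≤ k ∧ 0 < hatMu μ k := by
    obtain ⟨k, hk, hμk⟩ := h3
    obtain ⟨n, rfl⟩ : ∃ n, k = n + 1 := ⟨k - 1, by omega⟩
    exact ⟨n, by omega, div_pos (mul_pos (by positivity) hμk) hm1⟩
  have hF := strictMonoOn_mul_Gder_sub_Gfun hν hs hs1 h2
  have hc' : c ∈ Icc (0:ℝ) 1 := Ioo_subset_Icc_self hc
  have hQmem : ∀ t, Tgel μ ≤ t → Q t ∈ Icc (0:ℝ) 1 := fun t ht =>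
    ⟨(Real.exp_pos _).le.trans (hQ t ht).1.1.le, (hQ t ht).1.2⟩
  refine tendsto_order.2 ⟨fun a ha => ?_, fun a ha => ?_⟩
  · filter_upwards [eventually_ge_atTop (Tgel μ)] with t ht
    refine ha.trans_le ((hF.le_iff_le hc' (hQmem t ht)).1 ?_)
    have hpos := mul_nonneg (Real.exp_pos (-t)).le (Gder_nonneg hν (hQmem t ht).1)
    have heq := (hQ t ht).2
    linarith
  · rcases lt_or_ge 1 a with h1a | ha1
    · filter_upwards [eventually_ge_atTop (Tgel μ)] with t ht
      exact (hQ t ht).1.2.trans_lt h1a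
    · have ha' : a ∈ Icc (0:ℝ) 1 := ⟨hc.1.le.trans ha.le, ha1⟩
      have hFa := hF hc' ha' ha
      simp only [hceq, sub_self] at hFa
      have hlim : Tendsto (fun t => Real.exp (-t) * Gder (hatMu μ) 1) atTop (𝓝 0) := by
        simpa using Real.tendsto_exp_neg_atTop_nhds_zero.mul_const (Gder (hatMu μ) 1)
      filter_upwards [eventually_ge_atTop (Tgel μ), hlim.eventually_lt_const hFa] with t ht hlt
      refine (hF.lt_iff_lt (hQmem t ht) ha').1 ?_
      have hle := mul_le_mul_of_nonneg_left (Gder_le_Gder_one hν hs1 (hQmem t ht))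
        (Real.exp_pos (-t)).le
      have heq := (hQ t ht).2
      linarith
end

section
/- Uniqueness for the transport equation by the method of characteristics: let T ∈ ℝ, let q : [T,∞) → [0,∞) be continuous, and set Q(t) = exp(−∫_T^t q(s) ds) for t ≥ T. If u : [T,∞) × [0,1] → ℝ is continuously differentiable and satisfies ∂_t u(t,x) = −x·q(t)·∂_x u(t,x) for all t ≥ T and x ∈ [0,1], then u(t,x) = u(T, x·Q(t)) for all t ≥ T and x ∈ [0,1]. -/
open Set intervalIntegral

/-- Chain rule for `τ ↦ u τ (X τ)` relative to a set, when `u` has a partial derivative in the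
first variable at the point and a continuous partial derivative in the second variable. -/
theorem hasDerivWithinAt_curve_of_partial {S K : Set ℝ} (hK : Convex ℝ K)
    {u ux : ℝ → ℝ → ℝ} {X : ℝ → ℝ} {s a X' : ℝ} (hs : s ∈ S) (hX : MapsTo X S K)
    (hut : HasDerivWithinAt (fun τ => u τ (X s)) a S s)
    (hux : ∀ t ∈ S, ∀ y ∈ K, HasDerivWithinAt (fun z => u t z) (ux t y) K y)
    (huxc : ContinuousWithinAt (fun p : ℝ × ℝ => ux p.1 p.2) (S ×ˢ K) (s, X s))
    (hXd : HasDerivWithinAt X X' S s) :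
    HasDerivWithinAt (fun τ => u τ (X τ)) (a + ux s (X s) * X') S s := by
  have key : (fun τ => u τ (X τ) - u τ (X s) - ux s (X s) * (X τ - X s))
      =o[nhdsWithin s S] fun τ => X τ - X s := by
    rw [Asymptotics.isLittleO_iff]
    intro c hc
    obtain ⟨δ, hδ, hball⟩ := Metric.continuousWithinAt_iff.1 huxc c hc
    obtain ⟨η, hη, hXη⟩ := Metric.continuousWithinAt_iff.1 hXd.continuousWithinAt δ hδ
    have hnear : ∀ᶠ τ in nhdsWithin s S, dist τ s < min δ η :=
      mem_nhdsWithin_of_mem_nhds (Metric.ball_mem_nhds s (lt_min hδ hη))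
    filter_upwards [hnear, self_mem_nhdsWithin] with τ hτ hτS
    have hτδ := hτ.trans_le (min_le_left _ _)
    have hconv : Convex ℝ (K ∩ Metric.ball (X s) δ) := hK.inter (convex_ball _ _)
    have hd : ∀ y ∈ K ∩ Metric.ball (X s) δ,
        HasDerivWithinAt (fun z => u τ z - ux s (X s) * z) (ux τ y - ux s (X s))
          (K ∩ Metric.ball (X s) δ) y := by
      intro y hy
      have h := ((hux τ hτS y hy.1).mono inter_subset_left).sub
        ((hasDerivWithinAt_id y (K ∩ Metric.ball (X s) δ)).const_mul (ux s (X s)))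
      rw [mul_one] at h
      exact h
    have hbound : ∀ y ∈ K ∩ Metric.ball (X s) δ, ‖ux τ y - ux s (X s)‖ ≤ c := by
      intro y hy
      have hdist : dist (τ, y) (s, X s) < δ := by
        rw [Prod.dist_eq]
        exact max_lt hτδ hy.2
      have := hball (x := (τ, y)) ⟨hτS, hy.1⟩ hdist
      rw [dist_eq_norm] at this
      exact this.le
    have hmv := hconv.norm_image_sub_le_of_norm_hasDerivWithin_le hd hbound
      (x := X s) (y := X τ) ⟨hX hs, Metric.mem_ball_self hδ⟩
      ⟨hX hτS, hXη hτS (hτ.trans_le (min_le_right _ _))⟩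
    refine le_of_eq_of_le (congrArg norm ?_) hmv
    ring
  have hXO : (fun τ => X τ - X s) =O[nhdsWithin s S] fun τ => τ - s :=
    hXd.hasFDerivWithinAt.isBigO_sub
  rw [hasDerivWithinAt_iff_isLittleO] at hut hXd ⊢
  refine (((key.trans_isBigO hXO).add hut).add (hXd.const_mul_left (ux s (X s)))).congr_left ?_
  intro τ
  simp only [smul_eq_mul]
  ring



/-- uniqueness for the transport equation by the method of characteristics. -/
theorem stmt16
    (T : ℝ) (q : ℝ → ℝ)
    (hq0 : ∀ s ∈ Ici T, 0 ≤ q s) (hqc : ContinuousOn q (Ici T))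
    (u ut ux : ℝ → ℝ → ℝ)
    (hut : ∀ t ∈ Ici T, ∀ x ∈ Icc (0:ℝ) 1,
      HasDerivWithinAt (fun τ => u τ x) (ut t x) (Ici T) t)
    (hux : ∀ t ∈ Ici T, ∀ x ∈ Icc (0:ℝ) 1,
      HasDerivWithinAt (fun y => u t y) (ux t x) (Icc (0:ℝ) 1) x)
    (hutc : ContinuousOn (fun p : ℝ × ℝ => ut p.1 p.2) (Ici T ×ˢ Icc (0:ℝ) 1))
    (huxc : ContinuousOn (fun p : ℝ × ℝ => ux p.1 p.2) (Ici T ×ˢ Icc (0:ℝ) 1))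
    (hpde : ∀ t ∈ Ici T, ∀ x ∈ Icc (0:ℝ) 1, ut t x = - x * q t * ux t x) :
    ∀ t ∈ Ici T, ∀ x ∈ Icc (0:ℝ) 1,
      u t x = u T (x * Real.exp (-(∫ s in T..t, q s))) := by
  intro t ht x hx
  set r : ℝ → ℝ := fun s => q (max s T)
  have hr : Continuous r :=
    hqc.comp_continuous (continuous_id.max continuous_const) fun s => le_max_right s T
  have hrq : ∀ s ∈ Ici T, r s = q s := fun s hs => congrArg q (max_eq_left hs)
  have hr0 : ∀ s, 0 ≤ r s := fun s => hq0 _ (le_max_right s T)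
  set P : ℝ → ℝ := fun s => ∫ τ in T..s, r τ
  have hP : ∀ s, HasDerivAt P (r s) s := fun s =>
    integral_hasDerivAt_right (hr.intervalIntegrable _ _)
      hr.stronglyMeasurable.stronglyMeasurableAtFilter hr.continuousAt
  have hPmono : Monotone P :=
    monotone_of_deriv_nonneg (fun s => (hP s).differentiableAt)
      fun s => (hP s).deriv.symm ▸ hr0 s
  have hPt : P t = ∫ s in T..t, q s := by
    refine integral_congr fun s hs => hrq s ?_
    rw [uIcc_of_le ht] at hs
    exact hs.1
  have hPT : P T = 0 := integral_same
  set X : ℝ → ℝ := fun s => x * Real.exp (P s - P t)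
  have hXd : ∀ s, HasDerivAt X (X s * r s) s := fun s => by
    simpa only [X, mul_assoc] using (((hP s).sub_const (P t)).exp.const_mul x)
  have hXK : MapsTo X (Icc T t) (Icc 0 1) := fun s hs =>
    ⟨mul_nonneg hx.1 (Real.exp_pos _).le,
      mul_le_one₀ hx.2 (Real.exp_pos _).le
        (Real.exp_le_one_iff.2 (sub_nonpos.2 (hPmono hs.2)))⟩
  have hg : ∀ s ∈ Icc T t, HasDerivWithinAt (fun τ => u τ (X τ)) 0 (Icc T t) s := by
    intro s hs
    have h := hasDerivWithinAt_curve_of_partial (convex_Icc 0 1) hs hXK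
      ((hut s hs.1 (X s) (hXK hs)).mono Icc_subset_Ici_self)
      (fun τ hτ => hux τ hτ.1)
      ((huxc (s, X s) ⟨hs.1, hXK hs⟩).mono (prod_mono Icc_subset_Ici_self subset_rfl))
      (hXd s).hasDerivWithinAt
    convert h using 1
    rw [hpde s hs.1 (X s) (hXK hs), hrq s hs.1]
    ring
  have hconst := constant_of_derivWithin_zero
    (fun s hs => (hg s hs).differentiableWithinAt)
    (fun s hs => (hg s (Ico_subset_Icc_self hs)).derivWithin
      (uniqueDiffOn_Icc (hs.1.trans_lt hs.2) s (Ico_subset_Icc_self hs)))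
    t (right_mem_Icc.2 ht)
  simpa [X, hPT, hPt] using hconst
end

section
/- Explicit post-gelation solution for Poisson initial degrees: let λ > 1 and let μ be the Poisson(λ) distribution on ℕ, μ(k) = e^{−λ}λ^k/k!. Then μ̂ = μ (i.e. ν := μ̂ is again Poisson(λ)), T_gel = −log(1 − 1/λ), and for every t ≥ T_gel: (1) Q(t) = e^{−t} + 1/λ is the unique solution in (e^{−t},1] of (Q − e^{−t})·G_ν'(Q) = G_ν(Q); (2) G_μ(Q(t)) = exp(1 − λ + λe^{−t}); (3) for every x ∈ [0,1], G_μ((Q(t) − e^{−t})x + e^{−t}) / G_μ(Q(t)) = e^{x−1}, i.e. the normalized law of activated arms in solution is Poisson(1). -/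
open Set

/-- Poisson(λ) distribution on ℕ. -/
noncomputable def poissonPMF (lam : ℝ) (k : ℕ) : ℝ := Real.exp (-lam) * lam ^ k / (Nat.factorial k)

theorem succ_mul_poissonPMF_succ (lam : ℝ) (k : ℕ) :
    ((k : ℝ) + 1) * poissonPMF lam (k + 1) = lam * poissonPMF lam k := by
  have hk : (k : ℝ) + 1 ≠ 0 := by positivity
  have hf : (Nat.factorial k : ℝ) ≠ 0 := by positivity
  simp only [poissonPMF, Nat.factorial_succ, pow_succ]
  push_cast
  field_simp

theorem hasSum_poissonPMF_mul_pow (lam x : ℝ) :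
    HasSum (fun k : ℕ => poissonPMF lam k * x ^ k) (Real.exp (lam * (x - 1))) := by
  have h := (NormedSpace.expSeries_div_hasSum_exp (lam * x)).mul_left (Real.exp (-lam))
  rw [← Real.exp_eq_exp_ℝ, ← Real.exp_add] at h
  have hfun (k : ℕ) : poissonPMF lam k * x ^ k
      = Real.exp (-lam) * ((lam * x) ^ k / (Nat.factorial k)) := by
    simp only [poissonPMF, mul_pow]
    ring
  have hexp : lam * (x - 1) = -lam + lam * x := by ring
  simpa only [hfun, hexp] using h

theorem Gfun_poissonPMF (lam x : ℝ) : Gfun (poissonPMF lam) x = Real.exp (lam * (x - 1)) :=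
  (hasSum_poissonPMF_mul_pow lam x).tsum_eq

theorem Gder_poissonPMF (lam x : ℝ) :
    Gder (poissonPMF lam) x = lam * Real.exp (lam * (x - 1)) := by
  simp only [Gder, succ_mul_poissonPMF_succ, mul_assoc]
  exact ((hasSum_poissonPMF_mul_pow lam x).mul_left lam).tsum_eq

theorem hasSum_poissonPMF (lam : ℝ) : HasSum (poissonPMF lam) 1 := by
  simpa using hasSum_poissonPMF_mul_pow lam 1

theorem hasSum_mul_poissonPMF (lam : ℝ) :
    HasSum (fun k : ℕ => (k : ℝ) * poissonPMF lam k) lam := by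
  rw [← hasSum_nat_add_iff' 1]
  simpa [succ_mul_poissonPMF_succ] using (hasSum_poissonPMF lam).mul_left lam

theorem fm1_poissonPMF (lam : ℝ) : fm1 (poissonPMF lam) = lam :=
  (hasSum_mul_poissonPMF lam).tsum_eq

theorem fm2_poissonPMF (lam : ℝ) : fm2 (poissonPMF lam) = lam ^ 2 := by
  refine HasSum.tsum_eq ?_
  rw [← hasSum_nat_add_iff' 1]
  have h (k : ℕ) : ((k : ℝ) + 1) * k * poissonPMF lam (k + 1)
      = lam * (k * poissonPMF lam k) := by
    linear_combination (k : ℝ) * succ_mul_poissonPMF_succ lam k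
  simpa [h, sq] using (hasSum_mul_poissonPMF lam).mul_left lam

theorem hatMu_poissonPMF {lam : ℝ} (hlam : lam ≠ 0) :
    hatMu (poissonPMF lam) = poissonPMF lam := by
  funext k
  rw [hatMu, fm1_poissonPMF, succ_mul_poissonPMF_succ, mul_div_cancel_left₀ _ hlam]

theorem Tgel_poissonPMF {lam : ℝ} (hlam : lam ≠ 0) :
    Tgel (poissonPMF lam) = -Real.log (1 - 1 / lam) := by
  rw [Tgel, fm1_poissonPMF, fm2_poissonPMF]
  congr 3
  field_simp

/-- explicit post-gelation solution for Poisson initial degrees. -/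
theorem stmt17 (lam : ℝ) (hlam : 1 < lam) :
    (∀ k : ℕ, hatMu (poissonPMF lam) k = poissonPMF lam k) ∧
    Tgel (poissonPMF lam) = - Real.log (1 - 1 / lam) ∧
    ∀ t : ℝ, Tgel (poissonPMF lam) ≤ t →
      -- (1) Q(t) = e^{-t} + 1/λ is the unique solution in (e^{-t},1] of the tilt equation
      ((Real.exp (-t) + 1 / lam ∈ Ioc (Real.exp (-t)) 1 ∧
        (Real.exp (-t) + 1 / lam - Real.exp (-t)) *
            Gder (hatMu (poissonPMF lam)) (Real.exp (-t) + 1 / lam)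
          = Gfun (hatMu (poissonPMF lam)) (Real.exp (-t) + 1 / lam)) ∧
        (∀ x ∈ Ioc (Real.exp (-t)) 1,
          (x - Real.exp (-t)) * Gder (hatMu (poissonPMF lam)) x
              = Gfun (hatMu (poissonPMF lam)) x →
            x = Real.exp (-t) + 1 / lam)) ∧
      -- (2) the concentration in solution
      Gfun (poissonPMF lam) (Real.exp (-t) + 1 / lam)
        = Real.exp (1 - lam + lam * Real.exp (-t)) ∧
      -- (3) normalized law of activated arms in solution is Poisson(1)
      ∀ x ∈ Icc (0:ℝ) 1,
        Gfun (poissonPMF lam) ((Real.exp (-t) + 1 / lam - Real.exp (-t)) * x + Real.exp (-t)) /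
            Gfun (poissonPMF lam) (Real.exp (-t) + 1 / lam)
          = Real.exp (x - 1) := by
  have h0 : lam ≠ 0 := by positivity
  have hinv : 0 < 1 / lam := by positivity
  have hinv1 : 1 / lam < 1 := (div_lt_one (by positivity)).2 hlam
  refine ⟨congrFun (hatMu_poissonPMF h0), Tgel_poissonPMF h0, fun t ht => ?_⟩
  rw [Tgel_poissonPMF h0] at ht
  have hexp : Real.exp (-t) ≤ 1 - 1 / lam := by
    rw [← Real.le_log_iff_exp_le (by linarith)]
    linarith
  simp only [hatMu_poissonPMF h0, Gfun_poissonPMF, Gder_poissonPMF]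
  refine ⟨⟨⟨⟨by linarith, by linarith⟩, ?_⟩, fun x _ hx => ?_⟩, ?_, fun x _ => ?_⟩
  · field_simp
    ring
  · rw [← mul_assoc] at hx
    have hx' := mul_eq_right₀ (Real.exp_ne_zero _) |>.1 hx
    have := eq_div_of_mul_eq h0 hx'
    linarith
  · congr 1
    field_simp
    ring
  · rw [← Real.exp_sub]
    congr 1
    field_simp
    ring
end

section
/- Explicit post-gelation solution for constant initial degrees: let d ≥ 3 be an integer and let μ = δ_d be the Dirac mass at d. Then ν := μ̂ = δ_{d−1}, T_gel = −log((d−2)/(d−1)), and for every t ≥ T_gel: (1) Q(t) = e^{−t}·(d−1)/(d−2) is the unique solution in (e^{−t},1] of (Q − e^{−t})·G_ν'(Q) = G_ν(Q); (2) G_μ(Q(t)) = ((d−1)e^{−t}/(d−2))^d; (3) for every x ∈ [0,1], G_μ((Q(t) − e^{−t})x + e^{−t}) / G_μ(Q(t)) = (1 + (x−1)/(d−1))^d, i.e. the normalized law of activated arms in solution is Binomial(d, 1/(d−1)). -/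
open Set

/-- Dirac mass at d on ℕ. -/
def diracPMF (d : ℕ) (k : ℕ) : ℝ := if k = d then 1 else 0

theorem Gfun_diracPMF (n : ℕ) (x : ℝ) : Gfun (diracPMF n) x = x ^ n := by
  rw [Gfun, tsum_eq_single n fun k hk => by simp [diracPMF, hk]]
  simp [diracPMF]

theorem Gder_diracPMF_succ (n : ℕ) (x : ℝ) :
    Gder (diracPMF (n + 1)) x = ((n : ℝ) + 1) * x ^ n := by
  rw [Gder, tsum_eq_single n fun k hk => by simp [diracPMF, hk]]
  simp [diracPMF]

theorem fm1_diracPMF (n : ℕ) : fm1 (diracPMF n) = n := by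
  rw [fm1, tsum_eq_single n fun k hk => by simp [diracPMF, hk]]
  simp [diracPMF]

theorem fm2_diracPMF (n : ℕ) : fm2 (diracPMF n) = (n : ℝ) * ((n : ℝ) - 1) := by
  rw [fm2, tsum_eq_single n fun k hk => by simp [diracPMF, hk]]
  simp [diracPMF]

theorem hatMu_diracPMF_succ (n : ℕ) : hatMu (diracPMF (n + 1)) = diracPMF n := by
  funext k
  rw [hatMu, fm1_diracPMF]
  by_cases h : k = n
  · subst h
    have : (k : ℝ) + 1 ≠ 0 := by positivity
    simp [diracPMF, this]
  · simp [diracPMF, h]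

theorem Tgel_diracPMF (n : ℕ) (hn : 2 ≤ n) :
    Tgel (diracPMF n) = -Real.log (((n : ℝ) - 2) / ((n : ℝ) - 1)) := by
  have h : (2 : ℝ) ≤ n := by exact_mod_cast hn
  have h0 : (n : ℝ) ≠ 0 := by linarith
  have h1 : (n : ℝ) - 1 ≠ 0 := by linarith
  rw [Tgel, fm1_diracPMF, fm2_diracPMF]
  congr 2
  field_simp
  ring

/-- explicit post-gelation solution for constant initial degrees. -/
theorem stmt18 (d : ℕ) (hd : 3 ≤ d) :
    (∀ k : ℕ, hatMu (diracPMF d) k = diracPMF (d - 1) k) ∧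
    Tgel (diracPMF d) = - Real.log (((d : ℝ) - 2) / ((d : ℝ) - 1)) ∧
    ∀ t : ℝ, Tgel (diracPMF d) ≤ t →
      -- (1) Q(t) = e^{-t} (d-1)/(d-2) is the unique solution in (e^{-t},1]
      ((Real.exp (-t) * ((d : ℝ) - 1) / ((d : ℝ) - 2) ∈ Ioc (Real.exp (-t)) 1 ∧
        (Real.exp (-t) * ((d : ℝ) - 1) / ((d : ℝ) - 2) - Real.exp (-t)) *
            Gder (hatMu (diracPMF d)) (Real.exp (-t) * ((d : ℝ) - 1) / ((d : ℝ) - 2))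
          = Gfun (hatMu (diracPMF d)) (Real.exp (-t) * ((d : ℝ) - 1) / ((d : ℝ) - 2))) ∧
        (∀ x ∈ Ioc (Real.exp (-t)) 1,
          (x - Real.exp (-t)) * Gder (hatMu (diracPMF d)) x = Gfun (hatMu (diracPMF d)) x →
            x = Real.exp (-t) * ((d : ℝ) - 1) / ((d : ℝ) - 2))) ∧
      -- (2) the concentration in solution
      Gfun (diracPMF d) (Real.exp (-t) * ((d : ℝ) - 1) / ((d : ℝ) - 2))
        = (((d : ℝ) - 1) * Real.exp (-t) / ((d : ℝ) - 2)) ^ d ∧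
      -- (3) normalized law of activated arms in solution is Binomial(d, 1/(d-1))
      ∀ x ∈ Icc (0:ℝ) 1,
        Gfun (diracPMF d)
            ((Real.exp (-t) * ((d : ℝ) - 1) / ((d : ℝ) - 2) - Real.exp (-t)) * x + Real.exp (-t)) /
            Gfun (diracPMF d) (Real.exp (-t) * ((d : ℝ) - 1) / ((d : ℝ) - 2))
          = (1 + (x - 1) / ((d : ℝ) - 1)) ^ d := by
  obtain ⟨n, rfl⟩ : ∃ n, d = n + 3 := ⟨d - 3, by omega⟩
  have hT := Tgel_diracPMF (n + 3) (by omega)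
  have hhat : hatMu (diracPMF (n + 3)) = diracPMF (n + 2) := hatMu_diracPMF_succ (n + 2)
  refine ⟨fun k => by rw [hhat]; rfl, hT, fun t ht => ?_⟩
  simp only [hhat, Gfun_diracPMF, Gder_diracPMF_succ]
  have h2 : ((n + 3 : ℕ) : ℝ) - 2 = n + 1 := by push_cast; ring
  have h1 : ((n + 3 : ℕ) : ℝ) - 1 = n + 2 := by push_cast; ring
  rw [hT, h2, h1] at ht
  rw [h2, h1]
  have hn1 : (0 : ℝ) < n + 1 := by positivity
  have hn2 : (0 : ℝ) < n + 2 := by positivity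
  have hs : Real.exp (-t) ≤ ((n : ℝ) + 1) / (n + 2) := by
    rw [← Real.le_log_iff_exp_le (by positivity)]
    linarith
  have hs0 := Real.exp_pos (-t)
  clear ht
  generalize Real.exp (-t) = s at *
  rw [le_div_iff₀ hn2] at hs
  refine ⟨⟨⟨⟨?_, ?_⟩, ?_⟩, ?_⟩, ?_, ?_⟩
  · rw [lt_div_iff₀ hn1]
    nlinarith
  · rwa [div_le_one hn1]
  · push_cast
    rw [pow_succ _ (n + 1)]
    field_simp
    ring
  · rintro x ⟨hx, -⟩ h
    have hx0 : 0 < x := hs0.trans hx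
    rw [pow_succ _ (n + 1)] at h
    push_cast at h
    have h' : (x - s) * (n + 2) = x :=
      mul_right_cancel₀ (pow_pos hx0 (n + 1)).ne' (by linear_combination h)
    rw [eq_div_iff hn1.ne']
    linear_combination h'
  · rw [mul_comm s]
  · intro x _
    rw [← div_pow]
    congr 1
    field_simp
    ring
end

section
/- Explicit post-gelation solution for binomial initial degrees: let d ≥ 3 be an integer, p ∈ (1/(d−1), 1], and let μ = Binomial(d,p), μ(k) = C(d,k)p^k(1−p)^{d−k}. Then ν := μ̂ = Binomial(d−1,p), T_gel = −log(1 − 1/((d−1)p)), and for every t ≥ T_gel: (1) Q(t) = (1 − p + (d−1)p·e^{−t})/((d−2)p) is the unique solution in (e^{−t},1] of (Q − e^{−t})·G_ν'(Q) = G_ν(Q); (2) G_μ(Q(t)) = ((d−1)(1 − p + p·e^{−t})/(d−2))^d; (3) for every x ∈ [0,1], G_μ((Q(t) − e^{−t})x + e^{−t}) / G_μ(Q(t)) = (1 + (x−1)/(d−1))^d, i.e. the normalized law of activated arms in solution is Binomial(d, 1/(d−1)). -/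
open Set

/-- Binomial(d,p) distribution on ℕ. -/
noncomputable def binomPMF (d : ℕ) (p : ℝ) (k : ℕ) : ℝ :=
  (d.choose k : ℝ) * p ^ k * (1 - p) ^ (d - k)

theorem binomPMF_eq_zero_of_lt {n k : ℕ} (h : n < k) (p : ℝ) : binomPMF n p k = 0 := by
  simp [binomPMF, Nat.choose_eq_zero_of_lt h]

theorem succ_mul_binomPMF_succ (n : ℕ) (p : ℝ) (k : ℕ) :
    ((k : ℝ) + 1) * binomPMF (n + 1) p (k + 1) = ((n : ℝ) + 1) * p * binomPMF n p k := by
  have h : ((n : ℝ) + 1) * (n.choose k : ℝ) = ((n + 1).choose (k + 1) : ℝ) * ((k : ℝ) + 1) := by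
    exact_mod_cast Nat.add_one_mul_choose_eq n k
  simp only [binomPMF, Nat.add_sub_add_right, pow_succ]
  linear_combination (-(p ^ k * p * (1 - p) ^ (n - k))) * h

theorem summable_mul_binomPMF (f : ℕ → ℝ) (n : ℕ) (p : ℝ) :
    Summable fun k => f k * binomPMF n p k := by
  refine summable_of_ne_finset_zero (s := Finset.range (n + 1)) fun k hk => ?_
  rw [binomPMF_eq_zero_of_lt (by simpa using hk), mul_zero]

theorem Gfun_binomPMF (n : ℕ) (p x : ℝ) : Gfun (binomPMF n p) x = (1 - p + p * x) ^ n := by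
  rw [Gfun, tsum_eq_sum (s := Finset.range (n + 1)), add_comm (1 - p), add_pow]
  · refine Finset.sum_congr rfl fun k _ => ?_
    rw [binomPMF, mul_pow]
    ring
  · intro k hk
    rw [binomPMF_eq_zero_of_lt (by simpa using hk), zero_mul]

theorem Gder_binomPMF_succ (n : ℕ) (p x : ℝ) :
    Gder (binomPMF (n + 1) p) x = ((n : ℝ) + 1) * p * (1 - p + p * x) ^ n := by
  simp only [Gder, succ_mul_binomPMF_succ, mul_assoc (_ * p) (binomPMF n p _), tsum_mul_left]
  rw [← Gfun_binomPMF, Gfun]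

theorem fm1_binomPMF_succ (n : ℕ) (p : ℝ) : fm1 (binomPMF (n + 1) p) = ((n : ℝ) + 1) * p := by
  have h := Gder_binomPMF_succ n p 1
  rw [fm1, (summable_mul_binomPMF (fun k => (k : ℝ)) _ p).tsum_eq_zero_add]
  simpa [Gder] using h

theorem fm2_binomPMF_succ_succ (n : ℕ) (p : ℝ) :
    fm2 (binomPMF (n + 2) p) = ((n : ℝ) + 2) * p * (((n : ℝ) + 1) * p) := by
  rw [fm2, (summable_mul_binomPMF (fun k => (k : ℝ) * ((k : ℝ) - 1)) _ p).tsum_eq_zero_add,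
    ← fm1_binomPMF_succ, fm1, ← tsum_mul_left]
  simp only [CharP.cast_eq_zero, zero_mul, zero_add]
  refine tsum_congr fun k => ?_
  have h := succ_mul_binomPMF_succ (n + 1) p k
  push_cast at h ⊢
  linear_combination (k : ℝ) * h

theorem hatMu_binomPMF_succ (n : ℕ) {p : ℝ} (hp : p ≠ 0) :
    hatMu (binomPMF (n + 1) p) = binomPMF n p := by
  funext k
  have hn : (n : ℝ) + 1 ≠ 0 := by positivity
  rw [hatMu, succ_mul_binomPMF_succ, fm1_binomPMF_succ, mul_div_cancel_left₀ _ (mul_ne_zero hn hp)]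

theorem Tgel_binomPMF_succ_succ (n : ℕ) {p : ℝ} (hp : p ≠ 0) :
    Tgel (binomPMF (n + 2) p) = -Real.log (1 - 1 / (((n : ℝ) + 1) * p)) := by
  have hn : (n : ℝ) + 1 ≠ 0 := by positivity
  have hn' : (n : ℝ) + 2 ≠ 0 := by positivity
  rw [Tgel, fm2_binomPMF_succ_succ, fm1_binomPMF_succ (n + 1)]
  congr 3
  push_cast
  field_simp
  ring

/-- explicit post-gelation solution for binomial initial degrees. -/
theorem stmt19 (d : ℕ) (hd : 3 ≤ d) (p : ℝ) (hp : p ∈ Ioc (1 / ((d : ℝ) - 1)) 1) :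
    (∀ k : ℕ, hatMu (binomPMF d p) k = binomPMF (d - 1) p k) ∧
    Tgel (binomPMF d p) = - Real.log (1 - 1 / (((d : ℝ) - 1) * p)) ∧
    ∀ t : ℝ, Tgel (binomPMF d p) ≤ t →
      -- (1) Q(t) = (1 - p + (d-1) p e^{-t}) / ((d-2) p) is the unique solution in (e^{-t},1]
      (((1 - p + ((d : ℝ) - 1) * p * Real.exp (-t)) / (((d : ℝ) - 2) * p) ∈
          Ioc (Real.exp (-t)) 1 ∧
        ((1 - p + ((d : ℝ) - 1) * p * Real.exp (-t)) / (((d : ℝ) - 2) * p) - Real.exp (-t)) *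
            Gder (hatMu (binomPMF d p))
              ((1 - p + ((d : ℝ) - 1) * p * Real.exp (-t)) / (((d : ℝ) - 2) * p))
          = Gfun (hatMu (binomPMF d p))
              ((1 - p + ((d : ℝ) - 1) * p * Real.exp (-t)) / (((d : ℝ) - 2) * p))) ∧
        (∀ x ∈ Ioc (Real.exp (-t)) 1,
          (x - Real.exp (-t)) * Gder (hatMu (binomPMF d p)) x = Gfun (hatMu (binomPMF d p)) x →
            x = (1 - p + ((d : ℝ) - 1) * p * Real.exp (-t)) / (((d : ℝ) - 2) * p))) ∧
      -- (2) the concentration in solution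
      Gfun (binomPMF d p)
          ((1 - p + ((d : ℝ) - 1) * p * Real.exp (-t)) / (((d : ℝ) - 2) * p))
        = (((d : ℝ) - 1) * (1 - p + p * Real.exp (-t)) / ((d : ℝ) - 2)) ^ d ∧
      -- (3) normalized law of activated arms in solution is Binomial(d, 1/(d-1))
      ∀ x ∈ Icc (0:ℝ) 1,
        Gfun (binomPMF d p)
            (((1 - p + ((d : ℝ) - 1) * p * Real.exp (-t)) / (((d : ℝ) - 2) * p) - Real.exp (-t)) * x
              + Real.exp (-t)) /
            Gfun (binomPMF d p)
              ((1 - p + ((d : ℝ) - 1) * p * Real.exp (-t)) / (((d : ℝ) - 2) * p))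
          = (1 + (x - 1) / ((d : ℝ) - 1)) ^ d := by
  obtain ⟨n, rfl⟩ : ∃ n, d = n + 3 := ⟨d - 3, by omega⟩
  obtain ⟨hp1, hp2⟩ := hp
  have e1 : ((n + 3 : ℕ) : ℝ) - 1 = n + 2 := by push_cast; ring
  have e2 : ((n + 3 : ℕ) : ℝ) - 2 = n + 1 := by push_cast; ring
  simp only [e1, e2] at hp1 ⊢
  have hn1 : (0 : ℝ) < n + 1 := by positivity
  have hn2 : (0 : ℝ) < n + 2 := by positivity
  have hp0 : 0 < p := lt_trans (by positivity) hp1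
  have hT : Tgel (binomPMF (n + 3) p) = -Real.log (1 - 1 / (((n : ℝ) + 2) * p)) := by
    rw [Tgel_binomPMF_succ_succ (n + 1) hp0.ne']
    push_cast
    ring_nf
  have hhat := hatMu_binomPMF_succ (n + 2) hp0.ne'
  refine ⟨fun k => congrFun hhat k, hT, fun t ht => ?_⟩
  rw [hhat]
  have hlt : 1 < ((n : ℝ) + 2) * p := by
    rwa [div_lt_iff₀ hn2, mul_comm] at hp1
  have hpos : 0 < 1 - 1 / (((n : ℝ) + 2) * p) := by
    rw [sub_pos, div_lt_one (by positivity)]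
    exact hlt
  have hexp : Real.exp (-t) ≤ 1 - 1 / (((n : ℝ) + 2) * p) := by
    rw [← Real.le_log_iff_exp_le hpos]
    linarith
  have hE : 0 < Real.exp (-t) := Real.exp_pos _
  generalize Real.exp (-t) = E at hexp hE ⊢
  have hE1 : ((n : ℝ) + 2) * p * E ≤ ((n : ℝ) + 2) * p - 1 := by
    have := mul_le_mul_of_nonneg_left hexp (by positivity : 0 ≤ ((n : ℝ) + 2) * p)
    rwa [mul_sub, mul_one, mul_one_div_cancel (by positivity)] at this
  have hA : 0 < 1 - p + p * E := by nlinarith [mul_pos hp0 hE]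
  obtain ⟨Q, hQ⟩ : ∃ Q, Q = (1 - p + ((n : ℝ) + 2) * p * E) / (((n : ℝ) + 1) * p) := ⟨_, rfl⟩
  rw [← hQ]
  have hQ' : Q * (((n : ℝ) + 1) * p) = 1 - p + ((n : ℝ) + 2) * p * E := by
    rw [hQ, div_mul_cancel₀ _ (by positivity)]
  have hbase : 1 - p + p * Q = ((n : ℝ) + 2) * (1 - p + p * E) / ((n : ℝ) + 1) := by
    rw [eq_div_iff hn1.ne']
    linear_combination hQ'
  have hG (x : ℝ) := Gfun_binomPMF (n + 2) p x
  have hD (x : ℝ) := Gder_binomPMF_succ (n + 1) p x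
  simp only [hG, hD, Gfun_binomPMF, hbase]
  refine ⟨⟨⟨⟨?_, ?_⟩, ?_⟩, ?_⟩, trivial, ?_⟩
  · rw [hQ, lt_div_iff₀ (by positivity)]
    linarith
  · rw [hQ, div_le_one (by positivity)]
    linarith
  · rw [← hbase]
    push_cast
    linear_combination (1 - p + p * Q) ^ (n + 1) * hQ'
  · rintro x ⟨hx, -⟩ h
    have hy : 0 < 1 - p + p * x := by nlinarith [mul_lt_mul_of_pos_left hx hp0]
    rw [hQ, eq_div_iff (by positivity)]
    have hy' := (pow_pos hy (n + 1)).ne'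
    apply mul_right_cancel₀ hy'
    push_cast at h
    linear_combination h
  · rintro x -
    rw [← div_pow]
    congr 1
    have hlin : 1 - p + p * ((Q - E) * x + E) =
        (1 - p + p * E) * ((n : ℝ) + 1 + x) / ((n : ℝ) + 1) := by
      rw [eq_div_iff hn1.ne']
      linear_combination x * hQ'
    rw [hlin]
    have := hA.ne'
    field_simp
    ring
end
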